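/- arXiv:math/0110211 — 10 statements merged into one kernel-verified Lean document; each statement's English description precedes it below -/
import Mathlib

section
/- Let σ be a configuration of a chip firing game and let S be a finite set of vertices all of which are firable in σ. Then every enumeration v₁,…,vₙ of S is a valid firing sequence starting from σ (each vᵢ is firable in the configuration at the moment it is fired), and all enumerations of S lead from σ to the same final configuration. -/
/-- A chip firing game over vertex set `V` is given by an edge-multiplicity
function `E : V → V → ℕ`; `outdeg E v` is the out-degree of `v`. -/
def outdeg {V : Type*} [Fintype V] (E : V → V → ℕ) (v : V) : ℕ := ∑ w, E v w

/-- A vertex `v` is firable in the configuration `σ` if it holds at least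
as many chips as its out-degree. -/
def Firable {V : Type*} [Fintype V] (E : V → V → ℕ) (σ : V → ℕ) (v : V) : Prop :=
  outdeg E v ≤ σ v

/-- Firing the vertex `v` in the configuration `σ`. -/
def fire {V : Type*} [Fintype V] [DecidableEq V] (E : V → V → ℕ) (σ : V → ℕ) (v : V) :
    V → ℕ :=
  fun w => σ w + E v w - (if w = v then outdeg E v else 0)

/-- The configuration obtained from `σ` by firing the vertices of a list, in order. -/
def fireList {V : Type*} [Fintype V] [DecidableEq V] (E : V → V → ℕ) :
    (V → ℕ) → List V → (V → ℕ)
  | σ, [] => σ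
  | σ, v :: l => fireList E (fire E σ v) l

/-- A list of vertices is a valid firing sequence from `σ` if each vertex is
firable at the moment it is fired. -/
def ValidSeq {V : Type*} [Fintype V] [DecidableEq V] (E : V → V → ℕ) :
    (V → ℕ) → List V → Prop
  | _, [] => True
  | σ, v :: l => Firable E σ v ∧ ValidSeq E (fire E σ v) l

/-- `τ` is reachable from `σ` if some valid firing sequence leads from `σ` to `τ`. -/
def Reachable {V : Type*} [Fintype V] [DecidableEq V] (E : V → V → ℕ) (σ τ : V → ℕ) : Prop :=
  ∃ l : List V, ValidSeq E σ l ∧ fireList E σ l = τ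

/-- A CFG with initial configuration `σ₀` is convergent if some configuration with
no firable vertex is reachable from `σ₀`. -/
def Convergent {V : Type*} [Fintype V] [DecidableEq V] (E : V → V → ℕ) (σ₀ : V → ℕ) : Prop :=
  ∃ τ, Reachable E σ₀ τ ∧ ∀ v, ¬ Firable E τ v

/-- A CFG is simple if in every firing sequence starting from the initial
configuration, each vertex is fired at most once. -/
def SimpleCFG {V : Type*} [Fintype V] [DecidableEq V] (E : V → V → ℕ) (σ₀ : V → ℕ) : Prop :=
  ∀ l : List V, ValidSeq E σ₀ l → l.Nodup

/-- A firable vertex stays firable when another vertex is fired. -/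
theorem Firable.fire_of_ne {V : Type*} [Fintype V] [DecidableEq V] {E : V → V → ℕ}
    {σ : V → ℕ} {v w : V} (hw : Firable E σ w) (hne : w ≠ v) : Firable E (fire E σ v) w := by
  simp only [Firable, fire, if_neg hne] at hw ⊢
  omega

theorem fire_add_ite_outdeg {V : Type*} [Fintype V] [DecidableEq V] {E : V → V → ℕ}
    {σ : V → ℕ} {v : V} (hv : Firable E σ v) (w : V) :
    fire E σ v w + (if w = v then outdeg E v else 0) = σ w + E v w := by
  unfold Firable at hv
  unfold fire
  split_ifs with h
  · subst h
    omega
  · omega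

/-- A duplicate-free list of firable vertices is a valid firing sequence. -/
theorem validSeq_of_nodup {V : Type*} [Fintype V] [DecidableEq V] {E : V → V → ℕ}
    {σ : V → ℕ} {l : List V} (hl : l.Nodup) (hf : ∀ v ∈ l, Firable E σ v) :
    ValidSeq E σ l := by
  induction l generalizing σ with
  | nil => trivial
  | cons v l ih =>
    obtain ⟨hv, hl⟩ := List.nodup_cons.mp hl
    refine ⟨hf v List.mem_cons_self, ih hl fun w hw => ?_⟩
    exact (hf w (List.mem_cons_of_mem v hw)).fire_of_ne fun h => hv (h ▸ hw)

/-- Balance of the chips on a vertex `w` along a valid firing sequence. -/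
theorem ValidSeq.fireList_add_sum {V : Type*} [Fintype V] [DecidableEq V] {E : V → V → ℕ}
    {σ : V → ℕ} {l : List V} (hl : ValidSeq E σ l) (w : V) :
    fireList E σ l w + (l.map fun v => if w = v then outdeg E v else 0).sum =
      σ w + (l.map fun v => E v w).sum := by
  induction l generalizing σ with
  | nil => simp [fireList]
  | cons v l ih =>
    have h₁ := fire_add_ite_outdeg hl.1 w
    have h₂ := ih hl.2
    simp only [fireList, List.map_cons, List.sum_cons]
    omega

/-- Two valid firing sequences that are permutations of each other lead to the same
configuration. -/
theorem ValidSeq.fireList_eq_of_perm {V : Type*} [Fintype V] [DecidableEq V]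
    {E : V → V → ℕ} {σ : V → ℕ} {l₁ l₂ : List V} (h₁ : ValidSeq E σ l₁)
    (h₂ : ValidSeq E σ l₂) (h : l₁.Perm l₂) : fireList E σ l₁ = fireList E σ l₂ := by
  funext w
  have e₁ := h₁.fireList_add_sum w
  have e₂ := h₂.fireList_add_sum w
  rw [(h.map _).sum_eq, (h.map fun v => E v w).sum_eq] at e₁
  omega

/-- if all the vertices of a finite set `S` are firable in `σ`, then every
enumeration of `S` is a valid firing sequence from `σ`, and all enumerations of `S`
lead from `σ` to the same configuration. -/
theorem fire_set_valid_and_confluent {V : Type*} [Fintype V] [DecidableEq V]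
    (E : V → V → ℕ) (σ : V → ℕ) (S : Finset V) (hS : ∀ v ∈ S, Firable E σ v) :
    (∀ l : List V, l.Nodup → l.toFinset = S → ValidSeq E σ l) ∧
    (∀ l₁ l₂ : List V, l₁.Nodup → l₁.toFinset = S → l₂.Nodup → l₂.toFinset = S →
      fireList E σ l₁ = fireList E σ l₂) := by
  have hvalid : ∀ l : List V, l.Nodup → l.toFinset = S → ValidSeq E σ l :=
    fun l hl hlS => validSeq_of_nodup hl fun v hv => hS v (hlS ▸ List.mem_toFinset.mpr hv)
  refine ⟨hvalid, fun l₁ l₂ hl₁ hS₁ hl₂ hS₂ => ?_⟩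
  exact (hvalid l₁ hl₁ hS₁).fireList_eq_of_perm (hvalid l₂ hl₂ hS₂)
    (List.perm_of_nodup_nodup_toFinset_eq hl₁ hl₂ (hS₁.trans hS₂.symm))
end

section
/- Every convergent chip firing game is equivalent to a simple convergent chip firing game: for every convergent CFG C with initial configuration σ₀, there exists a simple convergent CFG C' with initial configuration σ₀' such that the configuration space of C' is order-isomorphic to the configuration space of C. -/
open Relation Finset

section Scripts

variable {V : Type*} [Fintype V] [DecidableEq V] {E : V → V → ℕ} {σ : V → ℕ}

/-- After each vertex `u` has been fired `s u` times from `σ`, the vertex `v` is firable. -/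
def Enabled (E : V → V → ℕ) (σ s : V → ℕ) (v : V) : Prop :=
  (s v + 1) * outdeg E v ≤ σ v + ∑ u, s u * E u v

/-- The firing vector `t` extends `s` by one legal firing. -/
def ScriptStep (E : V → V → ℕ) (σ s t : V → ℕ) : Prop :=
  ∃ v, Enabled E σ s v ∧ t = s + Pi.single v 1

/-- The firing vector `s` is realised by some valid firing sequence from `σ`. -/
def Legal (E : V → V → ℕ) (σ s : V → ℕ) : Prop :=
  ReflTransGen (ScriptStep E σ) 0 s

/-- Firing each vertex `u` exactly `s u` times turns `σ` into `τ`. -/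
def IsConfig (E : V → V → ℕ) (σ s τ : V → ℕ) : Prop :=
  ∀ w, τ w + s w * outdeg E w = σ w + ∑ u, s u * E u w

omit [DecidableEq V] in
theorem Enabled.mono {s t : V → ℕ} {v : V} (h : Enabled E σ s v) (hst : s ≤ t)
    (hv : t v = s v) : Enabled E σ t v := by
  unfold Enabled at *
  rw [hv]
  refine h.trans (Nat.add_le_add_left (sum_le_sum fun u _ => ?_) _)
  exact Nat.mul_le_mul_right _ (hst u)

theorem reflTransGen_sup {s t u : V → ℕ} (hu : ReflTransGen (ScriptStep E σ) s u)
    (hst : s ≤ t) : ReflTransGen (ScriptStep E σ) t (t ⊔ u) := by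
  induction hu with
  | refl => rw [sup_eq_left.2 hst]
  | @tail b c _ hbc ih =>
    obtain ⟨v, hv, rfl⟩ := hbc
    by_cases h : b v < t v
    · have : t ⊔ (b + Pi.single v 1) = t ⊔ b := by
        ext w
        by_cases hw : w = v
        · subst hw; simp; omega
        · simp [hw]
      rwa [this]
    · refine ih.tail ⟨v, hv.mono le_sup_right (by simp; omega), ?_⟩
      ext w
      by_cases hw : w = v
      · subst hw; simp; omega
      · simp [hw]

theorem le_of_reflTransGen {s t : V → ℕ} (h : ReflTransGen (ScriptStep E σ) s t) : s ≤ t := by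
  induction h with
  | refl => exact le_rfl
  | tail _ hbc ih =>
    obtain ⟨v, _, rfl⟩ := hbc
    exact ih.trans (fun w => by simp)

theorem Legal.reflTransGen {s t : V → ℕ} (ht : Legal E σ t) (hst : s ≤ t) :
    ReflTransGen (ScriptStep E σ) s t := by
  have h := reflTransGen_sup (t := s) ht zero_le
  rwa [sup_eq_right.2 hst] at h

theorem Legal.le_of_stable {s m : V → ℕ} (hs : Legal E σ s) (hm : ∀ v, ¬ Enabled E σ m v) :
    s ≤ m := by
  rcases (reflTransGen_sup hs zero_le).cases_head with h | ⟨c, ⟨v, hv, _⟩, _⟩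
  · exact sup_eq_left.1 h.symm
  · exact absurd hv (hm v)

omit [DecidableEq V] in
theorem IsConfig.firable_iff {s τ : V → ℕ} (h : IsConfig E σ s τ) (v : V) :
    Firable E τ v ↔ Enabled E σ s v := by
  unfold Firable Enabled
  rw [← h v, add_mul]
  omega

theorem IsConfig.fire {s τ : V → ℕ} (h : IsConfig E σ s τ) {v : V} (hv : Firable E τ v) :
    IsConfig E σ (s + Pi.single v 1) (fire E τ v) := by
  intro w
  have hs : ∑ u, (s + Pi.single v 1 : V → ℕ) u * E u w = ∑ u, s u * E u w + E v w := by
    simp [add_mul, sum_add_distrib, Pi.single_apply]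
  rw [hs, ← add_assoc, ← h w]
  unfold _root_.fire
  unfold Firable at hv
  by_cases hw : w = v
  · subst hw
    simp [add_mul]
    omega
  · simp [hw]
    omega

omit [DecidableEq V] in
theorem IsConfig.unique {s τ τ' : V → ℕ} (h : IsConfig E σ s τ) (h' : IsConfig E σ s τ') :
    τ = τ' := by
  ext w
  have := h w
  have := h' w
  omega

omit [DecidableEq V] in
theorem isConfig_zero : IsConfig E σ 0 σ := fun w => by simp

theorem IsConfig.fireList {s τ : V → ℕ} {l : List V} (h : IsConfig E σ s τ)
    (hl : ValidSeq E τ l) :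
    ReflTransGen (ScriptStep E σ) s (s + fun v => l.count v) ∧
      IsConfig E σ (s + fun v => l.count v) (fireList E τ l) := by
  induction l generalizing s τ with
  | nil =>
    have : (s + fun v => ([] : List V).count v) = s := by ext; simp
    rw [this]
    exact ⟨.refl, h⟩
  | cons v l ih =>
    have : (s + fun w => (v :: l).count w) = s + Pi.single v 1 + fun w => l.count w := by
      ext w
      by_cases hw : w = v
      · subst hw; simp; omega
      · simp [hw, Ne.symm hw]
    rw [this]
    obtain ⟨h1, h2⟩ := ih (h.fire hl.1) hl.2
    exact ⟨.head ⟨v, (h.firable_iff v).1 hl.1, rfl⟩ h1, h2⟩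

theorem IsConfig.exists_validSeq {s t τ : V → ℕ} (h : IsConfig E σ s τ)
    (hst : ReflTransGen (ScriptStep E σ) s t) :
    ∃ l : List V, ValidSeq E τ l ∧ t = s + fun v => l.count v := by
  induction hst using ReflTransGen.head_induction_on generalizing τ with
  | refl => exact ⟨[], trivial, by ext; simp⟩
  | head hac _ ih =>
    obtain ⟨v, hv, rfl⟩ := hac
    have hf := (h.firable_iff v).2 hv
    obtain ⟨l, hl, rfl⟩ := ih (h.fire hf)
    refine ⟨v :: l, ⟨hf, hl⟩, ?_⟩
    ext w
    by_cases hw : w = v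
    · subst hw; simp; omega
    · simp [hw, Ne.symm hw]

theorem IsConfig.exists_reachable {s t τ : V → ℕ} (h : IsConfig E σ s τ)
    (hst : ReflTransGen (ScriptStep E σ) s t) :
    ∃ τ', Reachable E τ τ' ∧ IsConfig E σ t τ' := by
  obtain ⟨l, hl, rfl⟩ := h.exists_validSeq hst
  exact ⟨_, ⟨l, hl, rfl⟩, (h.fireList hl).2⟩

theorem convergent_iff :
    Convergent E σ ↔ ∃ m, Legal E σ m ∧ ∀ v, ¬ Enabled E σ m v := by
  constructor
  · rintro ⟨_, ⟨l, hl, rfl⟩, hτ⟩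
    obtain ⟨h1, h2⟩ := isConfig_zero.fireList hl
    exact ⟨_, h1, fun v hv => hτ v ((h2.firable_iff v).2 hv)⟩
  · rintro ⟨m, hm, hs⟩
    obtain ⟨τ, hτ, hc⟩ := isConfig_zero.exists_reachable hm
    exact ⟨τ, hτ, fun v hv => hs v ((hc.firable_iff v).1 hv)⟩

theorem Legal.eq_of_isConfig (hconv : Convergent E σ) {s t τ : V → ℕ} (hs : Legal E σ s)
    (ht : Legal E σ t) (hsτ : IsConfig E σ s τ) (htτ : IsConfig E σ t τ) : s = t := by
  obtain ⟨m, hm, hstable⟩ := convergent_iff.1 hconv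
  obtain ⟨l, hl, rfl⟩ := hsτ.exists_validSeq (hm.reflTransGen (hs.le_of_stable hstable))
  obtain ⟨h1, h2⟩ := htτ.fireList hl
  have hstable' : ∀ v, ¬ Enabled E σ (t + fun v => l.count v) v := fun v hv =>
    hstable v (((hsτ.fireList hl).2.firable_iff v).1 ((h2.firable_iff v).2 hv))
  have heq := le_antisymm (hm.le_of_stable hstable')
    (Legal.le_of_stable (ReflTransGen.trans ht h1) hstable)
  exact add_right_cancel heq

/-- The configuration space of a convergent game is isomorphic to the set of its legal firing
vectors, ordered componentwise. -/
theorem exists_equiv_legal (hconv : Convergent E σ) :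
    ∃ e : {τ : V → ℕ // Reachable E σ τ} ≃ {s : V → ℕ // Legal E σ s},
      ∀ a b, Reachable E a.val b.val ↔ (e a).val ≤ (e b).val := by
  have hex : ∀ a : {τ : V → ℕ // Reachable E σ τ}, ∃ s, Legal E σ s ∧ IsConfig E σ s a.val := by
    rintro ⟨_, l, hl, rfl⟩
    obtain ⟨h1, h2⟩ := isConfig_zero.fireList hl
    exact ⟨_, h1, h2⟩
  choose f hf hc using hex
  have hbij : Function.Bijective fun a => (⟨f a, hf a⟩ : {s : V → ℕ // Legal E σ s}) := by
    constructor
    · intro a b hab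
      have hab' : f a = f b := congrArg Subtype.val hab
      exact Subtype.ext ((hc a).unique (hab' ▸ hc b))
    · rintro ⟨s, hs⟩
      obtain ⟨τ, hτ, hsτ⟩ := isConfig_zero.exists_reachable hs
      exact ⟨⟨τ, hτ⟩, Subtype.ext (Legal.eq_of_isConfig hconv (hf _) hs (hc _) hsτ)⟩
  refine ⟨Equiv.ofBijective _ hbij, fun a b => ⟨?_, fun hab => ?_⟩⟩
  · rintro ⟨l, hl, hlb⟩
    obtain ⟨h1, h2⟩ := (hc a).fireList hl
    rw [hlb] at h2
    have := Legal.eq_of_isConfig hconv (ReflTransGen.trans (hf a) h1) (hf b) h2 (hc b)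
    exact (le_of_reflTransGen h1).trans this.le
  · obtain ⟨τ', hτ', hc'⟩ := (hc a).exists_reachable ((hf b).reflTransGen hab)
    rwa [← hc'.unique (hc b)]

end Scripts

section Unfolding

variable {V W : Type*} [Fintype V] [Fintype W] [DecidableEq W]
  (f : W ≃ V) (K : ℕ) (E : V → V → ℕ) (σ : V → ℕ)

/-- The number of chips by which a copy of a vertex unlocks the next copy; it exceeds anything
a vertex can hold when every vertex is fired at most `K` times. -/
def unlock : ℕ := 1 + ∑ v, σ v + K * ∑ v, outdeg E v

/-- The common out-degree of all copies. -/
def copyDeg : ℕ := unlock K E σ + K * ∑ v, outdeg E v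

/-- The number of edges between two copies: those of the original game, and the ones by which a
copy unlocks the next copy of the same vertex. -/
def copyEdge (x y : W × Fin K) : ℕ :=
  E (f x.1) (f y.1) + if x.1 = y.1 ∧ x.2.val + 1 = y.2.val then unlock K E σ else 0

/-- The game in which every vertex is split into `K` copies, the `i`-th copy playing the role of
the `i`-th firing; the additional vertex `none` absorbs superfluous chips. -/
def unfoldEdge : Option (W × Fin K) → Option (W × Fin K) → ℕ
  | none, none => Fintype.card (W × Fin K) * copyDeg K E σ + 1
  | none, some _ => 0
  | some x, none => copyDeg K E σ - ∑ y, copyEdge f K E σ x y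
  | some x, some y => copyEdge f K E σ x y

/-- The initial configuration of the split game. -/
def unfoldInit : Option (W × Fin K) → ℕ
  | none => 0
  | some x => copyDeg K E σ + σ (f x.1) -
      ((x.2.val + 1) * outdeg E (f x.1) + if x.2.val = 0 then 0 else unlock K E σ)

/-- The firing vector of the split game corresponding to `s`: the first `s v` copies of `v` are
fired once. -/
def unfoldScript (s : V → ℕ) : Option (W × Fin K) → ℕ
  | none => 0
  | some x => if x.2.val < s (f x.1) then 1 else 0

variable {f K E σ}

theorem sum_copyEdge_le (x : W × Fin K) : ∑ y, copyEdge f K E σ x y ≤ copyDeg K E σ := by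
  have h1 : ∑ y : W × Fin K, E (f x.1) (f y.1) ≤ K * ∑ v, outdeg E v := by
    rw [Fintype.sum_prod_type]
    simp only [sum_const, card_univ, Fintype.card_fin, smul_eq_mul, ← mul_sum]
    rw [Equiv.sum_comp f (fun v => E (f x.1) v)]
    exact Nat.mul_le_mul_left _
      (single_le_sum (f := fun v => outdeg E v) (fun _ _ => Nat.zero_le _) (mem_univ (f x.1)))
  have h2 : ∑ y : W × Fin K, (if x.1 = y.1 ∧ x.2.val + 1 = y.2.val then unlock K E σ else 0) ≤
      unlock K E σ := by
    rw [← sum_filter, sum_const, smul_eq_mul]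
    refine (Nat.mul_le_mul_right _ (card_le_one.2 ?_)).trans (one_mul _).le
    intro a ha b hb
    simp only [mem_filter, mem_univ, true_and] at ha hb
    exact Prod.ext (ha.1.symm.trans hb.1) (Fin.ext (ha.2.symm.trans hb.2))
  simp only [copyEdge, sum_add_distrib, copyDeg]
  omega

theorem outdeg_unfoldEdge_some (x : W × Fin K) :
    outdeg (unfoldEdge f K E σ) (some x) = copyDeg K E σ := by
  have := sum_copyEdge_le (f := f) (E := E) (σ := σ) x
  simp only [outdeg, Fintype.sum_option, unfoldEdge]
  omega

theorem outdeg_unfoldEdge_none :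
    outdeg (unfoldEdge f K E σ) none = Fintype.card (W × Fin K) * copyDeg K E σ + 1 := by
  simp [outdeg, Fintype.sum_option, unfoldEdge]

omit [Fintype V] [Fintype W] [DecidableEq W] in
theorem sum_unfoldScript {s : V → ℕ} (hs : ∀ v, s v ≤ K) (a : W) :
    ∑ j : Fin K, (if j.val < s (f a) then 1 else 0) = s (f a) := by
  rw [Fin.sum_univ_eq_sum_range (fun j => if j < s (f a) then 1 else 0) K, ← sum_filter,
    sum_const, smul_eq_mul, mul_one]
  have : (range K).filter (· < s (f a)) = range (s (f a)) := by
    ext j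
    have := hs (f a)
    simp only [mem_filter, mem_range]
    omega
  rw [this, card_range]

theorem sum_unfoldScript_mul_copyEdge {s : V → ℕ} (hs : ∀ v, s v ≤ K) (x : W × Fin K) :
    ∑ y : W × Fin K, unfoldScript f K s (some y) * copyEdge f K E σ y x =
      ∑ u, s u * E u (f x.1) +
        if x.2.val ≠ 0 ∧ x.2.val ≤ s (f x.1) then unlock K E σ else 0 := by
  simp only [copyEdge, mul_add, sum_add_distrib]
  congr 1
  · rw [Fintype.sum_prod_type]
    simp only [unfoldScript, ← sum_mul, sum_unfoldScript hs]
    exact Equiv.sum_comp f (fun u => s u * E u (f x.1))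
  · obtain ⟨a, i⟩ := x
    split_ifs with h
    · obtain ⟨h0, hi⟩ := h
      simp only at h0 hi
      have hlt : i.val - 1 < K := by omega
      rw [sum_eq_single (a, ⟨i.val - 1, hlt⟩)]
      · have h1 : i.val - 1 < s (f a) := by omega
        have h2 : i.val - 1 + 1 = i.val := by omega
        simp [unfoldScript, h1, h2]
      · rintro ⟨b, j⟩ _ hne
        have : ¬ (b = a ∧ j.val + 1 = i.val) := by
          rintro ⟨rfl, hj⟩
          exact hne (Prod.ext rfl (Fin.ext (by simp only; omega)))
        simp [this]
      · simp
    · refine sum_eq_zero ?_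
      rintro ⟨b, j⟩ _
      simp only [unfoldScript]
      split_ifs with h1 h2
      · obtain ⟨rfl, h2⟩ := h2
        simp only at h
        omega
      all_goals simp

theorem add_sum_lt_unlock {s : V → ℕ} (hs : ∀ v, s v ≤ K) (v : V) :
    σ v + ∑ u, s u * E u v < unlock K E σ := by
  have h1 : σ v ≤ ∑ v, σ v := single_le_sum (fun _ _ => Nat.zero_le _) (mem_univ v)
  have h2 : ∑ u, s u * E u v ≤ K * ∑ u, outdeg E u := by
    rw [mul_sum]
    exact sum_le_sum fun u _ => Nat.mul_le_mul (hs u)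
      (single_le_sum (f := fun w => E u w) (fun _ _ => Nat.zero_le _) (mem_univ v))
  unfold unlock
  omega

theorem not_enabled_unfold_none (s : V → ℕ) :
    ¬ Enabled (unfoldEdge f K E σ) (unfoldInit f K E σ) (unfoldScript f K s) none := by
  have h : ∑ x : W × Fin K, unfoldScript f K s (some x) * unfoldEdge f K E σ (some x) none ≤
      Fintype.card (W × Fin K) * copyDeg K E σ := by
    rw [← card_univ, ← smul_eq_mul]
    refine sum_le_card_nsmul _ _ _ fun x _ => ?_
    have : unfoldScript f K s (some x) ≤ 1 := by
      simp only [unfoldScript]; split_ifs <;> simp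
    refine (Nat.mul_le_mul this (Nat.sub_le _ _)).trans ?_
    rw [one_mul]
  rw [Enabled, outdeg_unfoldEdge_none, Fintype.sum_option]
  simp only [unfoldScript, unfoldInit, zero_add, one_mul, zero_mul] at h ⊢
  omega

theorem enabled_unfold_some {s : V → ℕ} (hs : ∀ v, s v ≤ K) (x : W × Fin K) :
    Enabled (unfoldEdge f K E σ) (unfoldInit f K E σ) (unfoldScript f K s) (some x) ↔
      x.2.val = s (f x.1) ∧ Enabled E σ s (f x.1) := by
  have hlt := add_sum_lt_unlock (E := E) (σ := σ) hs (f x.1)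
  have hK : (x.2.val + 1) * outdeg E (f x.1) ≤ K * ∑ v, outdeg E v :=
    Nat.mul_le_mul x.2.isLt
      (single_le_sum (f := fun v => outdeg E v) (fun _ _ => Nat.zero_le _) (mem_univ (f x.1)))
  rw [Enabled, outdeg_unfoldEdge_some, Fintype.sum_option]
  have hsum := sum_unfoldScript_mul_copyEdge (f := f) (E := E) (σ := σ) hs x
  simp only [unfoldEdge] at hsum ⊢
  rw [hsum]
  simp only [mul_zero, zero_add, unfoldScript, unfoldInit, Enabled, copyDeg]
  rcases lt_trichotomy x.2.val (s (f x.1)) with h | h | h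
  · rw [if_pos h]
    split_ifs <;> omega
  · rw [← h, if_neg (lt_irrefl _)]
    split_ifs <;> omega
  · rw [if_neg h.not_gt]
    split_ifs <;> omega

omit [Fintype V] [Fintype W] in
theorem unfoldScript_add_single [DecidableEq V] (s : V → ℕ) (x : W × Fin K)
    (hx : x.2.val = s (f x.1)) :
    unfoldScript f K (s + Pi.single (f x.1) 1) = unfoldScript f K s + Pi.single (some x) 1 := by
  funext y
  obtain _ | ⟨b, j⟩ := y
  · simp [unfoldScript]
  · obtain ⟨a, i⟩ := x
    simp only at hx
    by_cases hb : b = a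
    · subst hb
      by_cases hj : j = i
      · subst hj
        simp [unfoldScript, hx]
      · have : j.val ≠ i.val := fun h => hj (Fin.ext h)
        have h' : j.val < s (f b) + 1 ↔ j.val < s (f b) := by omega
        simp [unfoldScript, hj, h']
    · simp [unfoldScript, hb]

omit [Fintype V] [Fintype W] [DecidableEq W] in
theorem unfoldScript_le_iff {s t : V → ℕ} (hs : ∀ v, s v ≤ K) :
    unfoldScript f K s ≤ unfoldScript f K t ↔ s ≤ t := by
  constructor
  · intro h v
    by_contra! hv
    have := hs v
    have h' := h (some (f.symm v, ⟨t v, hv.trans_le this⟩))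
    simp [unfoldScript, hv] at h'
  · rintro h (_ | x)
    · exact le_rfl
    · have : s (f x.1) ≤ t (f x.1) := h (f x.1)
      simp only [unfoldScript]
      split_ifs <;> omega

omit [Fintype V] [Fintype W] [DecidableEq W] in
theorem unfoldScript_zero : unfoldScript f K 0 = 0 := by
  funext y
  cases y <;> simp [unfoldScript]

variable [DecidableEq V]

theorem Legal.unfold (hK : ∀ s, Legal E σ s → ∀ v, s v ≤ K) {s : V → ℕ} (hs : Legal E σ s) :
    Legal (unfoldEdge f K E σ) (unfoldInit f K E σ) (unfoldScript f K s) := by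
  induction hs with
  | refl => rw [unfoldScript_zero]; exact .refl
  | @tail b c hb hbc ih =>
    have hc : Legal E σ c := hb.tail hbc
    obtain ⟨v, hv, rfl⟩ := hbc
    have hlt : b v < K := by simpa using hK _ hc v
    obtain ⟨a, rfl⟩ := f.surjective v
    exact ih.tail ⟨some (a, ⟨b (f a), hlt⟩), (enabled_unfold_some (hK b hb) _).2 ⟨rfl, hv⟩,
      unfoldScript_add_single b (a, ⟨b (f a), hlt⟩) rfl⟩

theorem Legal.exists_unfoldScript (hK : ∀ s, Legal E σ s → ∀ v, s v ≤ K)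
    {t : Option (W × Fin K) → ℕ} (ht : Legal (unfoldEdge f K E σ) (unfoldInit f K E σ) t) :
    ∃ s, Legal E σ s ∧ unfoldScript f K s = t := by
  induction ht with
  | refl => exact ⟨0, .refl, unfoldScript_zero⟩
  | tail _ hbc ih =>
    obtain ⟨s, hs, rfl⟩ := ih
    obtain ⟨_ | x, hx, rfl⟩ := hbc
    · exact absurd hx (not_enabled_unfold_none s)
    · obtain ⟨hi, hv⟩ := (enabled_unfold_some (hK s hs) x).1 hx
      exact ⟨_, ReflTransGen.tail hs ⟨_, hv, rfl⟩, unfoldScript_add_single s x hi⟩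

end Unfolding

/-- every convergent CFG is equivalent to a simple convergent CFG, i.e. there
is a simple convergent CFG whose configuration space (reachable configurations ordered by
reachability) is order-isomorphic to that of the original game. -/
theorem exists_simple_equivalent {V : Type*} [Fintype V] [DecidableEq V]
    (E : V → V → ℕ) (σ₀ : V → ℕ) (hconv : Convergent E σ₀) :
    ∃ (V' : Type) (iF : Fintype V') (iD : DecidableEq V') (E' : V' → V' → ℕ) (σ₀' : V' → ℕ),
      Convergent E' σ₀' ∧ SimpleCFG E' σ₀' ∧
      ∃ e : {τ : V → ℕ // Reachable E σ₀ τ} ≃ {τ' : V' → ℕ // Reachable E' σ₀' τ'},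
        ∀ a b : {τ : V → ℕ // Reachable E σ₀ τ},
          Reachable E a.val b.val ↔ Reachable E' (e a).val (e b).val := by
  obtain ⟨m, hm, hstable⟩ := convergent_iff.1 hconv
  let f := (Fintype.equivFin V).symm
  let K := ∑ v, m v
  have hK : ∀ s, Legal E σ₀ s → ∀ v, s v ≤ K := fun s hs v =>
    (hs.le_of_stable hstable v).trans (single_le_sum (fun _ _ => Nat.zero_le _) (mem_univ v))
  have hconv' : Convergent (unfoldEdge f K E σ₀) (unfoldInit f K E σ₀) := by
    refine convergent_iff.2 ⟨_, hm.unfold hK, ?_⟩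
    rintro (_ | x) hx
    · exact not_enabled_unfold_none m hx
    · exact hstable _ ((enabled_unfold_some (hK m hm) x).1 hx).2
  refine ⟨Option (Fin (Fintype.card V) × Fin K), inferInstance, inferInstance,
    unfoldEdge f K E σ₀, unfoldInit f K E σ₀, hconv', fun l hl => ?_, ?_⟩
  · obtain ⟨s, -, hs⟩ := Legal.exists_unfoldScript hK (isConfig_zero.fireList hl).1
    refine (@List.nodup_iff_count_le_one _ instBEqOfDecidableEq _ l).2 fun x => ?_
    have hx := congrFun hs x
    simp only [Pi.add_apply, Pi.zero_apply, zero_add] at hx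
    rw [← hx]
    cases x
    · exact Nat.zero_le _
    · simp only [unfoldScript]
      split_ifs <;> simp
  · obtain ⟨e₁, he₁⟩ := exists_equiv_legal hconv
    obtain ⟨e₂, he₂⟩ := exists_equiv_legal hconv'
    let g : {s // Legal E σ₀ s} →
        {t // Legal (unfoldEdge f K E σ₀) (unfoldInit f K E σ₀) t} :=
      fun s => ⟨unfoldScript f K s.val, s.property.unfold hK⟩
    have hg : ∀ s t, (g s).val ≤ (g t).val ↔ s.val ≤ t.val := fun s t =>
      unfoldScript_le_iff (hK _ s.property)
    have hbij : Function.Bijective g := by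
      constructor
      · intro s t hst
        exact Subtype.ext (le_antisymm ((hg s t).1 (by rw [hst])) ((hg t s).1 (by rw [hst])))
      · rintro ⟨t, ht⟩
        obtain ⟨s, hs, rfl⟩ := ht.exists_unfoldScript hK
        exact ⟨⟨s, hs⟩, rfl⟩
    refine ⟨(e₁.trans (Equiv.ofBijective g hbij)).trans e₂.symm, fun a b => ?_⟩
    rw [he₁, he₂]
    simp [hg]
end

section
/- In a convergent chip firing game, if two firing sequences starting from the same configuration σ lead to the same configuration τ, then each vertex is fired the same number of times in both sequences; in particular, the sets of vertices fired in the two sequences coincide. -/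
section

variable {V : Type*} [Fintype V] [DecidableEq V] {E : V → V → ℕ} {σ : V → ℕ} {v w : V}

/-- Firing a vertex preserves the firability of every other vertex. -/
theorem Firable.fire_of_ne_s4 (hv : Firable E σ v) (h : v ≠ w) : Firable E (fire E σ w) v := by
  unfold Firable fire at *
  simp only [if_neg h]
  omega

/-- The firings of two distinct firable vertices commute. -/
theorem fire_fire_comm (hv : Firable E σ v) (hw : Firable E σ w) (h : v ≠ w) :
    fire E (fire E σ v) w = fire E (fire E σ w) v := by
  funext x
  unfold Firable fire at *
  by_cases hxv : x = v
  · subst hxv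
    simp only [if_neg h, if_true]
    omega
  · simp only [if_neg hxv]
    by_cases hxw : x = w
    · subst hxw
      simp only [if_true]
      omega
    · simp only [if_neg hxw]
      omega

/-- A list of vertices stabilizes `σ` if it is a valid firing sequence from `σ` that leads to a
configuration with no firable vertex. -/
def Stabilizes (E : V → V → ℕ) (σ : V → ℕ) (s : List V) : Prop :=
  ValidSeq E σ s ∧ ∀ v, ¬ Firable E (fireList E σ s) v

/-- A firable vertex occurs in every stabilizing sequence, and its first occurrence can be moved
to the front. -/
theorem Stabilizes.erase {s : List V} (hs : Stabilizes E σ s) (hv : Firable E σ v) :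
    v ∈ s ∧ Stabilizes E (fire E σ v) (s.erase v) := by
  induction s generalizing σ with
  | nil => exact absurd hv (hs.2 v)
  | cons w s ih =>
    obtain ⟨⟨hw, hs⟩, hend⟩ := hs
    by_cases h : v = w
    · subst h
      rw [List.erase_cons_head]
      exact ⟨List.mem_cons_self, hs, hend⟩
    · obtain ⟨hmem, hvalid, hstable⟩ := ih ⟨hs, hend⟩ (hv.fire_of_ne_s4 h)
      rw [List.erase_cons_tail (by simpa using Ne.symm h)]
      rw [← fire_fire_comm hv hw h] at hvalid hstable
      exact ⟨List.mem_cons_of_mem _ hmem, ⟨hw.fire_of_ne_s4 (Ne.symm h), hvalid⟩, hstable⟩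

/-- Every valid firing sequence extends to a rearrangement of any given stabilizing sequence. -/
theorem Stabilizes.exists_perm_append {s t : List V} (hs : Stabilizes E σ s)
    (ht : ValidSeq E σ t) :
    ∃ m, Stabilizes E (fireList E σ t) m ∧ s.Perm (t ++ m) := by
  induction t generalizing σ s with
  | nil => exact ⟨s, hs, List.Perm.refl s⟩
  | cons v t ih =>
    obtain ⟨hmem, hs⟩ := hs.erase ht.1
    obtain ⟨m, hm, hperm⟩ := ih hs ht.2
    exact ⟨m, hm, (List.perm_cons_erase hmem).trans (hperm.cons v)⟩

/-- Any two sequences stabilizing the same configuration are rearrangements of each other. -/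
theorem Stabilizes.perm {s t : List V} (hs : Stabilizes E σ s) (ht : Stabilizes E σ t) :
    s.Perm t := by
  obtain ⟨m, hm, hperm⟩ := hs.exists_perm_append ht.1
  cases m with
  | nil => simpa using hperm
  | cons v m => exact absurd hm.1.1 (ht.2 v)

end

/-- in a convergent CFG, if two firing sequences starting from the same
configuration `σ` lead to the same configuration `τ`, then each vertex is fired the same
number of times in both sequences; in particular the sets of fired vertices coincide. -/
theorem count_eq_of_same_target {V : Type*} [Fintype V] [DecidableEq V]
    (E : V → V → ℕ) (σ τ : V → ℕ) (hconv : Convergent E σ)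
    (l₁ l₂ : List V) (h₁ : ValidSeq E σ l₁) (h₂ : ValidSeq E σ l₂)
    (e₁ : fireList E σ l₁ = τ) (e₂ : fireList E σ l₂ = τ) :
    (∀ v : V, l₁.count v = l₂.count v) ∧ l₁.toFinset = l₂.toFinset := by
  obtain ⟨_, ⟨s, hs, rfl⟩, hstable⟩ := hconv
  obtain ⟨m₁, hm₁, hp₁⟩ := Stabilizes.exists_perm_append ⟨hs, hstable⟩ h₁
  obtain ⟨m₂, hm₂, hp₂⟩ := Stabilizes.exists_perm_append ⟨hs, hstable⟩ h₂
  rw [e₁] at hm₁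
  rw [e₂] at hm₂
  have hperm : l₁.Perm l₂ := (List.perm_append_right_iff m₁).mp
    (hp₁.symm.trans (hp₂.trans ((hm₂.perm hm₁).append_left l₂)))
  exact ⟨fun v => hperm.count_eq v, List.toFinset_eq_of_perm _ _ hperm⟩
end

section
/- For a simple convergent chip firing game with initial configuration σ₀, the family of valid shot-sets is closed under union: if A and B are valid shot-sets, then so is A ∪ B. Consequently, the shot-set of the join of two reachable configurations a and b in the configuration space is sh(a ∨ b) = sh(a) ∪ sh(b). -/
/-- A subset `X ⊆ V` is a valid shot-set if it is the set of vertices fired along some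
valid firing sequence from the initial configuration. -/
def ValidShotSet {V : Type*} [Fintype V] [DecidableEq V] (E : V → V → ℕ) (σ₀ : V → ℕ)
    (X : Finset V) : Prop :=
  ∃ l : List V, ValidSeq E σ₀ l ∧ l.toFinset = X

theorem nodup_append_filter {V : Type*} [DecidableEq V] {l m : List V}
    (hl : l.Nodup) (hm : m.Nodup) :
    (l ++ m.filter (· ∉ l)).Nodup := by
  refine hl.append (hm.filter _) fun x hx hx' => ?_
  simp_all

theorem toFinset_append_filter {V : Type*} [DecidableEq V] (l m : List V) :
    (l ++ m.filter (· ∉ l)).toFinset = l.toFinset ∪ m.toFinset := by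
  ext x
  by_cases hx : x ∈ l <;> simp [hx]

section ChipFiring

variable {V : Type*} [Fintype V] [DecidableEq V] {E : V → V → ℕ}

theorem validSeq_append {σ : V → ℕ} {l m : List V} :
    ValidSeq E σ (l ++ m) ↔ ValidSeq E σ l ∧ ValidSeq E (fireList E σ l) m := by
  induction l generalizing σ with
  | nil => simp [ValidSeq, fireList]
  | cons v l ih => simp [ValidSeq, fireList, ih, and_assoc]

theorem fireList_append {σ : V → ℕ} {l m : List V} :
    fireList E σ (l ++ m) = fireList E (fireList E σ l) m := by
  induction l generalizing σ with
  | nil => rfl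
  | cons v l ih => exact ih

/-- Conservation of chips at the vertex `w` along a valid firing sequence. -/
theorem ValidSeq.fireList_add {σ : V → ℕ} {l : List V} (h : ValidSeq E σ l) (w : V) :
    fireList E σ l w + l.count w * outdeg E w = σ w + (l.map (E · w)).sum := by
  induction l generalizing σ with
  | nil => simp [fireList]
  | cons v l ih =>
    obtain ⟨hv, hl⟩ := h
    have key := ih hl
    simp only [fireList, List.map_cons, List.sum_cons]
    by_cases hw : w = v
    · subst hw
      unfold Firable at hv
      simp only [fire, if_true] at key
      rw [List.count_cons_self, add_mul, one_mul]
      omega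
    · rw [List.count_cons_of_ne (Ne.symm hw)]
      simp only [fire, if_neg hw] at key
      omega

/-- The configuration reached depends only on how often each vertex is fired. -/
theorem ValidSeq.fireList_eq_of_perm_s5 {σ : V → ℕ} {l m : List V} (hl : ValidSeq E σ l)
    (hm : ValidSeq E σ m) (hp : l.Perm m) : fireList E σ l = fireList E σ m := by
  funext w
  have h₁ := hl.fireList_add w
  have h₂ := hm.fireList_add w
  rw [hp.count_eq, (hp.map (E · w)).sum_eq] at h₁
  omega

/-- After a valid firing sequence `l`, the vertices of another valid firing sequence `m`
which were not fired yet can be fired in the order of `m`. -/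
theorem ValidSeq.append_filter {σ : V → ℕ} {l m : List V} (hl : ValidSeq E σ l)
    (hm : ValidSeq E σ m) (hmn : m.Nodup) : ValidSeq E σ (l ++ m.filter (· ∉ l)) := by
  induction m using List.reverseRecOn with
  | nil => simpa using hl
  | append_singleton p v ih =>
    obtain ⟨hp, hv⟩ := validSeq_append.1 hm
    have hpn : p.Nodup := hmn.of_append_left
    have hvp : v ∉ p := fun h => List.disjoint_of_nodup_append hmn h (by simp)
    have ih := ih hp hpn
    by_cases hvl : v ∈ l
    · simpa [List.filter_append, hvl] using ih
    · have hvf : v ∉ l ++ p.filter (· ∉ l) := by simp [hvl, hvp]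
      have hsub : p.Subperm (l ++ p.filter (· ∉ l)) :=
        List.subperm_of_subset hpn fun x hx => by
          by_cases hxl : x ∈ l <;> simp [hxl, hx]
      obtain ⟨q, hqp, hqs⟩ := hsub
      have hle : (p.map (E · v)).sum ≤ ((l ++ p.filter (· ∉ l)).map (E · v)).sum := by
        rw [← (hqp.map (E · v)).sum_eq]
        exact (hqs.map _).sum_le_sum fun _ _ => Nat.zero_le _
      have h₁ := hp.fireList_add v
      have h₂ := ih.fireList_add v
      rw [List.count_eq_zero_of_not_mem hvp] at h₁
      rw [List.count_eq_zero_of_not_mem hvf] at h₂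
      have hfire : outdeg E v ≤ fireList E σ p v := hv.1
      have : (p ++ [v]).filter (· ∉ l) = p.filter (· ∉ l) ++ [v] := by
        simp [List.filter_append, hvl]
      rw [this, ← List.append_assoc, validSeq_append]
      refine ⟨ih, ?_, trivial⟩
      change outdeg E v ≤ _
      omega

/-- If the shot-set of `l` is contained in that of `m`, then the configuration reached by `m`
is reachable from the one reached by `l`. -/
theorem ValidSeq.reachable_of_subset {σ : V → ℕ} {l m : List V} (hl : ValidSeq E σ l)
    (hm : ValidSeq E σ m) (hln : l.Nodup) (hmn : m.Nodup) (hlm : l ⊆ m) :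
    Reachable E (fireList E σ l) (fireList E σ m) := by
  have h := hl.append_filter hm hmn
  refine ⟨m.filter (· ∉ l), (validSeq_append.1 h).2, ?_⟩
  rw [← fireList_append]
  refine h.fireList_eq_of_perm_s5 hm ?_
  refine List.perm_of_nodup_nodup_toFinset_eq (nodup_append_filter hln hmn) hmn ?_
  rw [toFinset_append_filter, Finset.union_eq_right]
  intro x hx
  simp only [List.mem_toFinset] at hx ⊢
  exact hlm hx

/-- A valid firing sequence only fires vertices fired by a sequence reaching a
configuration without firable vertices. -/
theorem ValidSeq.subset_of_stable {σ : V → ℕ} {l t : List V} (hl : ValidSeq E σ l)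
    (hln : l.Nodup) (ht : ValidSeq E σ t) (hst : ∀ v, ¬ Firable E (fireList E σ t) v) :
    l ⊆ t := by
  have h := (validSeq_append.1 (ht.append_filter hl hln)).2
  have hnil : l.filter (· ∉ t) = [] := by
    cases hf : l.filter (· ∉ t) with
    | nil => rfl
    | cons v r =>
      rw [hf] at h
      exact absurd h.1 (hst v)
  intro x hx
  simpa using List.filter_eq_nil_iff.1 hnil x hx

/-- In a simple convergent game, the shot-set is determined by the configuration reached. -/
theorem SimpleCFG.subset_of_fireList_eq {σ₀ : V → ℕ} (hsimple : SimpleCFG E σ₀)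
    (hconv : Convergent E σ₀) {l m : List V} (hl : ValidSeq E σ₀ l) (hm : ValidSeq E σ₀ m)
    (h : fireList E σ₀ l = fireList E σ₀ m) : l ⊆ m := by
  obtain ⟨τ, ⟨t, ht, rfl⟩, hst⟩ := hconv
  have hlt : l ⊆ t := hl.subset_of_stable (hsimple l hl) ht hst
  obtain ⟨r, hr, hrt⟩ :=
    hl.reachable_of_subset ht (hsimple l hl) (hsimple t ht) hlt
  have hlr : ValidSeq E σ₀ (l ++ r) := validSeq_append.2 ⟨hl, hr⟩
  have hmr : ValidSeq E σ₀ (m ++ r) := validSeq_append.2 ⟨hm, h ▸ hr⟩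
  have hmr_eq : fireList E σ₀ (m ++ r) = fireList E σ₀ t := by
    rw [fireList_append, ← h, hrt]
  have htmr : t ⊆ m ++ r :=
    ht.subset_of_stable (hsimple t ht) hmr (hmr_eq ▸ hst)
  intro x hx
  rcases List.mem_append.1 (htmr (hlt hx)) with hxm | hxr
  · exact hxm
  · exact absurd hxr (List.disjoint_of_nodup_append (hsimple _ hlr) hx)

end ChipFiring

/-- for a simple convergent CFG, the valid shot-sets are closed under union.
Consequently, for reachable configurations `a` and `b` (with respective shot-sets
`la.toFinset` and `lb.toFinset`), there is a configuration `c` with shot-set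
`la.toFinset ∪ lb.toFinset` which is the join of `a` and `b` in the configuration space:
`sh (a ⊔ b) = sh a ∪ sh b`. -/
theorem shotSet_union {V : Type*} [Fintype V] [DecidableEq V]
    (E : V → V → ℕ) (σ₀ : V → ℕ) (hconv : Convergent E σ₀) (hsimple : SimpleCFG E σ₀) :
    (∀ A B : Finset V, ValidShotSet E σ₀ A → ValidShotSet E σ₀ B →
      ValidShotSet E σ₀ (A ∪ B)) ∧
    (∀ (a b : V → ℕ) (la lb : List V),
      ValidSeq E σ₀ la → fireList E σ₀ la = a →
      ValidSeq E σ₀ lb → fireList E σ₀ lb = b →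
      ∃ (c : V → ℕ) (lc : List V),
        ValidSeq E σ₀ lc ∧ fireList E σ₀ lc = c ∧
        lc.toFinset = la.toFinset ∪ lb.toFinset ∧
        Reachable E a c ∧ Reachable E b c ∧
        ∀ d : V → ℕ, Reachable E a d → Reachable E b d → Reachable E c d) := by
  refine ⟨?_, ?_⟩
  · rintro _ _ ⟨la, ha, rfl⟩ ⟨lb, hb, rfl⟩
    exact ⟨_, ha.append_filter hb (hsimple lb hb), toFinset_append_filter la lb⟩
  · rintro _ _ la lb ha rfl hb rfl
    have hc := ha.append_filter hb (hsimple lb hb)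
    have hcs := toFinset_append_filter la lb
    have hmem : ∀ x, x ∈ la ++ lb.filter (· ∉ la) ↔ x ∈ la ∨ x ∈ lb := fun x => by
      rw [← List.mem_toFinset, hcs, Finset.mem_union, List.mem_toFinset, List.mem_toFinset]
    refine ⟨_, _, hc, rfl, hcs, ?_, ?_, ?_⟩
    · exact ha.reachable_of_subset hc (hsimple _ ha) (hsimple _ hc)
        fun x hx => (hmem x).2 (Or.inl hx)
    · exact hb.reachable_of_subset hc (hsimple _ hb) (hsimple _ hc)
        fun x hx => (hmem x).2 (Or.inr hx)
    · rintro d ⟨l, hl, rfl⟩ ⟨m, hm, hd⟩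
      have hal : ValidSeq E σ₀ (la ++ l) := validSeq_append.2 ⟨ha, hl⟩
      have hbm : ValidSeq E σ₀ (lb ++ m) := validSeq_append.2 ⟨hb, hm⟩
      rw [← fireList_append, ← fireList_append] at hd
      rw [← fireList_append (l := la) (m := l)]
      refine hc.reachable_of_subset hal (hsimple _ hc) (hsimple _ hal) fun x hx => ?_
      rcases (hmem x).1 hx with hxa | hxb
      · exact List.mem_append_left _ hxa
      · exact hsimple.subset_of_fireList_eq hconv hbm hal hd (List.mem_append_left _ hxb)
end

section
/- Let L be a finite lattice that is order-isomorphic to the configuration space of some convergent chip firing game. Then for any elements a ≤ b of L, the interval [a, b] of L is also order-isomorphic to the configuration space of some convergent chip firing game. -/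
/-- A preordered type is (order-isomorphic to) the configuration space of a convergent
chip firing game if there is a convergent CFG and an equivalence with its set of
reachable configurations under which the order corresponds to reachability. -/
def CFGSpace (α : Type*) [Preorder α] : Prop :=
  ∃ (V : Type) (iF : Fintype V) (iD : DecidableEq V) (E : V → V → ℕ) (σ₀ : V → ℕ),
    Convergent E σ₀ ∧
    ∃ e : α ≃ {τ : V → ℕ // Reachable E σ₀ τ},
      ∀ x y : α, x ≤ y ↔ Reachable E (e x).val (e y).val

namespace ChipFiring

section Greedy

variable {V : Type*} [DecidableEq V]

/-- One step of the game on firing vectors in which `v` may be incremented at `n` iff `P n v`. -/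
def VecStep (P : (V → ℕ) → V → Prop) (n m : V → ℕ) : Prop :=
  ∃ v, P n v ∧ m = n + Pi.single v 1

/-- Reachability of firing vectors. -/
abbrev VecReach (P : (V → ℕ) → V → Prop) : (V → ℕ) → (V → ℕ) → Prop :=
  Relation.ReflTransGen (VecStep P)

theorem VecReach.le {P : (V → ℕ) → V → Prop} {n m : V → ℕ} (h : VecReach P n m) : n ≤ m := by
  induction h with
  | refl => exact le_rfl
  | tail _ hs ih =>
    obtain ⟨v, -, rfl⟩ := hs
    exact ih.trans (le_add_of_nonneg_right (zero_le))

theorem VecReach.sup {P : (V → ℕ) → V → Prop}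
    (hP : ∀ n m v, n ≤ m → n v = m v → P n v → P m v) {z m n : V → ℕ}
    (h : VecReach P z m) (hn : z ≤ n) : VecReach P n (n ⊔ m) := by
  induction h with
  | refl => rw [sup_eq_left.2 hn]
  | @tail b c _ hs ih =>
    obtain ⟨v, hv, rfl⟩ := hs
    by_cases hlt : b v < n v
    · have : n ⊔ (b + Pi.single v 1) = n ⊔ b := by
        ext w
        rcases eq_or_ne w v with rfl | hw
        · simp; omega
        · simp [hw]
      rwa [this]
    · push Not at hlt
      refine ih.tail ⟨v, hP b _ v le_sup_right (by simp [hlt]) hv, ?_⟩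
      ext w
      rcases eq_or_ne w v with rfl | hw
      · simp; omega
      · simp [hw]

end Greedy

section Vectors

variable {V : Type*} [Fintype V]

/-- The vertex `v` can fire once every vertex `w` has fired `n w` times, starting from `σ`. -/
def VecFirable (E : V → V → ℕ) (σ n : V → ℕ) (v : V) : Prop :=
  outdeg E v * (n v + 1) ≤ σ v + ∑ w, n w * E w v

theorem VecFirable.mono (E : V → V → ℕ) (σ n m : V → ℕ) (v : V) (hnm : n ≤ m)
    (hv : n v = m v) (h : VecFirable E σ n v) : VecFirable E σ m v := by
  unfold VecFirable at *
  rw [← hv]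
  refine h.trans ?_
  gcongr with w
  exact hnm w

/-- No vertex has sent out more chips than it received. -/
def Admissible (E : V → V → ℕ) (σ n : V → ℕ) : Prop :=
  ∀ v, outdeg E v * n v ≤ σ v + ∑ w, n w * E w v

/-- The configuration obtained from `σ` after every vertex `v` has fired `n v` times. -/
def config (E : V → V → ℕ) (σ n : V → ℕ) : V → ℕ :=
  fun v => σ v + ∑ w, n w * E w v - outdeg E v * n v

variable {E : V → V → ℕ} {σ : V → ℕ}

theorem admissible_zero : Admissible E σ 0 := by
  intro v; simp

theorem config_zero : config E σ 0 = σ := by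
  ext v; simp [config]

theorem Admissible.firable_iff {n : V → ℕ} (hn : Admissible E σ n) (v : V) :
    Firable E (config E σ n) v ↔ VecFirable E σ n v := by
  have := hn v
  unfold Firable VecFirable config
  rw [mul_add, mul_one]
  omega

variable [DecidableEq V]

theorem sum_add_single_mul (f n : V → ℕ) (v : V) :
    ∑ w, (n + Pi.single v 1 : V → ℕ) w * f w = ∑ w, n w * f w + f v := by
  simp [add_mul, Finset.sum_add_distrib, Pi.single_apply]

theorem Admissible.add_single {n : V → ℕ} (hn : Admissible E σ n) {v : V}
    (hv : VecFirable E σ n v) : Admissible E σ (n + Pi.single v 1) := by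
  intro w
  rw [sum_add_single_mul (fun u => E u w)]
  rcases eq_or_ne w v with rfl | hw
  · have : outdeg E w * (n w + 1) ≤ _ := hv
    simp only [Pi.add_apply, Pi.single_eq_same]
    omega
  · have := hn w
    simp only [Pi.add_apply, Pi.single_eq_of_ne hw, add_zero]
    omega

theorem Admissible.fire_config {n : V → ℕ} (hn : Admissible E σ n) (v : V) :
    fire E (config E σ n) v = config E σ (n + Pi.single v 1) := by
  ext w
  have := hn w
  unfold fire config
  rw [sum_add_single_mul (fun u => E u w)]
  rcases eq_or_ne w v with rfl | hw
  · simp only [Pi.add_apply, Pi.single_eq_same, mul_add, mul_one, if_true]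
    omega
  · simp only [Pi.add_apply, Pi.single_eq_of_ne hw, add_zero, if_neg hw]
    omega

theorem Admissible.of_vecReach {n m : V → ℕ} (hn : Admissible E σ n)
    (h : VecReach (VecFirable E σ) n m) : Admissible E σ m := by
  induction h with
  | refl => exact hn
  | tail _ hs ih =>
    obtain ⟨v, hv, rfl⟩ := hs
    exact ih.add_single hv

theorem reachable_iff_reflTransGen {τ : V → ℕ} :
    Reachable E σ τ ↔
      Relation.ReflTransGen (fun ρ ρ' => ∃ v, Firable E ρ v ∧ ρ' = fire E ρ v) σ τ := by
  constructor
  · rintro ⟨l, hl, rfl⟩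
    induction l generalizing σ with
    | nil => exact .refl
    | cons v l ih => exact .head ⟨v, hl.1, rfl⟩ (ih hl.2)
  · intro h
    induction h using Relation.ReflTransGen.head_induction_on with
    | refl => exact ⟨[], trivial, rfl⟩
    | head hs _ ih =>
      obtain ⟨v, hv, rfl⟩ := hs
      obtain ⟨l, hl, hτ⟩ := ih
      exact ⟨v :: l, ⟨hv, hl⟩, hτ⟩

theorem Admissible.reachable_config_iff {n : V → ℕ} (hn : Admissible E σ n) {τ : V → ℕ} :
    Reachable E (config E σ n) τ ↔ ∃ m, VecReach (VecFirable E σ) n m ∧ config E σ m = τ := by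
  rw [reachable_iff_reflTransGen]
  constructor
  · intro h
    induction h with
    | refl => exact ⟨n, .refl, rfl⟩
    | tail _ hs ih =>
      obtain ⟨v, hv, rfl⟩ := hs
      obtain ⟨m, hm, rfl⟩ := ih
      have hm' := hn.of_vecReach hm
      exact ⟨_, hm.tail ⟨v, (hm'.firable_iff v).1 hv, rfl⟩, (hm'.fire_config v).symm⟩
  · rintro ⟨m, h, rfl⟩
    induction h with
    | refl => exact .refl
    | tail hm hs ih =>
      obtain ⟨v, hv, rfl⟩ := hs
      have hm' := hn.of_vecReach hm
      exact ih.tail ⟨v, (hm'.firable_iff v).2 hv, (hm'.fire_config v).symm⟩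

theorem VecReach.translate {n n' m : V → ℕ} (hn : Admissible E σ n) (hn' : Admissible E σ n')
    (heq : config E σ n = config E σ n') (h : VecReach (VecFirable E σ) n m) :
    ∃ r, m = n + r ∧ VecReach (VecFirable E σ) n' (n' + r) ∧
      config E σ (n + r) = config E σ (n' + r) := by
  induction h with
  | refl => exact ⟨0, by simp, by simpa using .refl, by simpa⟩
  | tail hm hs ih =>
    obtain ⟨v, hv, rfl⟩ := hs
    obtain ⟨r, rfl, hr, hc⟩ := ih
    have h1 := hn.of_vecReach hm
    have h2 := hn'.of_vecReach hr
    refine ⟨r + Pi.single v 1, add_assoc _ _ _, hr.tail ⟨v, ?_, (add_assoc _ _ _).symm⟩, ?_⟩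
    · rwa [← h2.firable_iff, ← hc, h1.firable_iff]
    · rw [← add_assoc, ← add_assoc, ← h1.fire_config, ← h2.fire_config, hc]

variable (E σ) in
/-- The firing vectors of valid firing sequences starting from `σ`. -/
abbrev Feasible : Type _ := {n : V → ℕ // VecReach (VecFirable E σ) 0 n}

theorem Feasible.admissible (n : Feasible E σ) : Admissible E σ n.1 :=
  admissible_zero.of_vecReach n.2

theorem Feasible.vecReach_iff (n m : Feasible E σ) :
    VecReach (VecFirable E σ) n.1 m.1 ↔ n ≤ m := by
  refine ⟨fun h => h.le, fun h => ?_⟩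
  have := VecReach.sup (VecFirable.mono E σ) m.2 (zero_le (a := n.1))
  rwa [sup_eq_right.2 h] at this

theorem reachable_iff_exists_feasible {τ : V → ℕ} :
    Reachable E σ τ ↔ ∃ n : Feasible E σ, config E σ n.1 = τ := by
  have := (admissible_zero (E := E) (σ := σ)).reachable_config_iff (τ := τ)
  rw [config_zero] at this
  simpa using this

theorem convergent_iff :
    Convergent E σ ↔ ∃ t : Feasible E σ, ∀ v, ¬ VecFirable E σ t.1 v := by
  constructor
  · rintro ⟨τ, hτ, h⟩
    obtain ⟨t, rfl⟩ := reachable_iff_exists_feasible.1 hτ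
    exact ⟨t, fun v hv => h v ((t.admissible.firable_iff v).2 hv)⟩
  · rintro ⟨t, h⟩
    exact ⟨_, reachable_iff_exists_feasible.2 ⟨t, rfl⟩,
      fun v hv => h v ((t.admissible.firable_iff v).1 hv)⟩

theorem Feasible.le_terminal {t : Feasible E σ} (ht : ∀ v, ¬ VecFirable E σ t.1 v)
    (n : Feasible E σ) : n ≤ t := by
  have h := VecReach.sup (VecFirable.mono E σ) n.2 (zero_le (a := t.1))
  rcases h.cases_head with h | ⟨_, ⟨v, hv, -⟩, -⟩
  · exact sup_eq_left.1 h.symm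
  · exact absurd hv (ht v)

theorem Feasible.config_injective (hc : Convergent E σ) :
    Function.Injective fun n : Feasible E σ => config E σ n.1 := by
  obtain ⟨t, ht⟩ := convergent_iff.1 hc
  have key : ∀ n m : Feasible E σ, config E σ n.1 = config E σ m.1 → m ≤ n := by
    intro n m h
    obtain ⟨r, hr, hm, -⟩ := VecReach.translate n.admissible m.admissible h
      ((n.vecReach_iff t).2 (Feasible.le_terminal ht n))
    have : m.1 + r ≤ t.1 := Feasible.le_terminal ht ⟨m.1 + r, m.2.trans hm⟩
    rw [hr] at this
    exact fun v => by simpa using this v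
  exact fun n m h => le_antisymm (key m n h.symm) (key n m h)

theorem Feasible.reachable_iff (hc : Convergent E σ) (n m : Feasible E σ) :
    Reachable E (config E σ n.1) (config E σ m.1) ↔ n ≤ m := by
  rw [n.admissible.reachable_config_iff, ← n.vecReach_iff]
  refine ⟨?_, fun h => ⟨m.1, h, rfl⟩⟩
  rintro ⟨m', h, he⟩
  have : (⟨m', n.2.trans h⟩ : Feasible E σ) = m := Feasible.config_injective hc he
  rwa [← this]

/-- In a convergent game, firing vectors are in bijection with reachable configurations. -/
noncomputable def Feasible.equivReachable (hc : Convergent E σ) :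
    Feasible E σ ≃ {τ : V → ℕ // Reachable E σ τ} :=
  Equiv.ofBijective (fun n => ⟨config E σ n.1, reachable_iff_exists_feasible.2 ⟨n, rfl⟩⟩)
    ⟨fun _ _ h => Feasible.config_injective hc (congrArg Subtype.val h),
      fun τ => (reachable_iff_exists_feasible.1 τ.2).imp fun _ h => Subtype.ext h⟩

end Vectors

theorem cfgSpace_iff (α : Type*) [Preorder α] :
    CFGSpace α ↔ ∃ (V : Type) (_ : Fintype V) (_ : DecidableEq V) (E : V → V → ℕ) (σ : V → ℕ),
      Convergent E σ ∧ Nonempty (α ≃o Feasible E σ) := by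
  constructor
  · rintro ⟨V, _, _, E, σ, hc, e, he⟩
    refine ⟨V, _, _, E, σ, hc, ⟨⟨e.trans (Feasible.equivReachable hc).symm, ?_⟩⟩⟩
    intro x y
    obtain ⟨n, hn⟩ := (Feasible.equivReachable hc).surjective (e x)
    obtain ⟨m, hm⟩ := (Feasible.equivReachable hc).surjective (e y)
    rw [he, ← hn, ← hm]
    simp only [Equiv.trans_apply, ← hn, ← hm, Equiv.symm_apply_apply]
    exact (Feasible.reachable_iff hc n m).symm
  · rintro ⟨V, _, _, E, σ, hc, ⟨e⟩⟩
    refine ⟨V, _, _, E, σ, hc, e.toEquiv.trans (Feasible.equivReachable hc), fun x y => ?_⟩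
    rw [← e.le_iff_le]
    exact (Feasible.reachable_iff hc _ _).symm

section Interval

variable {V : Type} (E : V → V → ℕ) (σ a b : V → ℕ)

/-- One vertex for each firing separating the firing vector `a` from `b`. -/
abbrev Copy : Type := Σ v : V, Fin (b v - a v)

/-- The firing vector on copies corresponding to a firing vector `n` between `a` and `b`. -/
def copyVec (n : V → ℕ) : Option (Copy a b) → ℕ
  | some x => if a x.1 + x.2 < n x.1 then 1 else 0
  | none => 0

variable {a b}

theorem copyVec_self : copyVec a b a = 0 := by
  ext (_ | x) <;> simp [copyVec]

theorem copyVec_le_iff {n m : V → ℕ} (hm : a ≤ m) (hb : n ≤ b) :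
    copyVec a b n ≤ copyVec a b m ↔ n ≤ m := by
  constructor
  · intro h v
    by_contra! hlt
    replace hlt : m v < n v := hlt
    have hv : a v ≤ m v := hm v
    have hbv : n v ≤ b v := hb v
    have := h (some ⟨v, ⟨m v - a v, by omega⟩⟩)
    simp only [copyVec, Nat.add_sub_cancel' hv, hlt, if_true, lt_irrefl, if_false] at this
    omega
  · rintro h (_ | x)
    · exact le_rfl
    · have : n x.1 ≤ m x.1 := h x.1
      simp only [copyVec]
      split_ifs <;> omega

theorem sum_fin_ite_lt (p q k : ℕ) (h : q ≤ p + k) :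
    ∑ i : Fin k, (if p + (i : ℕ) < q then 1 else 0) = q - p := by
  rw [Fin.sum_univ_eq_sum_range (fun i => if p + i < q then 1 else 0), Finset.sum_boole]
  have : (Finset.range k).filter (fun i => p + i < q) = Finset.range (q - p) := by
    ext i; simp; omega
  simp [this]

theorem sum_copy [Fintype V] (f : V → ℕ) :
    ∑ x : Copy a b, f x.1 = ∑ v, (b v - a v) * f v := by
  simp [Fintype.sum_sigma]

theorem sum_copyVec_mul [Fintype V] {n : V → ℕ} (hab : a ≤ b) (hb : n ≤ b) (f : V → ℕ) :
    ∑ x : Copy a b, copyVec a b n (some x) * f x.1 = ∑ v, (n v - a v) * f v := by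
  rw [Fintype.sum_sigma]
  refine Finset.sum_congr rfl fun v _ => ?_
  simp only [copyVec]
  rw [← Finset.sum_mul, sum_fin_ite_lt]
  have : a v ≤ b v := hab v
  have : n v ≤ b v := hb v
  omega

variable [DecidableEq V]

theorem copyVec_add_single {n : V → ℕ} (x : Copy a b) (hx : a x.1 + x.2 = n x.1) :
    copyVec a b (n + Pi.single x.1 1) = copyVec a b n + Pi.single (some x) 1 := by
  obtain ⟨v, i⟩ := x
  ext (_ | ⟨w, j⟩)
  · simp [copyVec]
  · rcases eq_or_ne w v with rfl | hw
    · dsimp only at hx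
      rcases eq_or_ne j i with rfl | hj
      · simp [copyVec, hx]
      · have : (j : ℕ) ≠ i := fun h => hj (Fin.ext h)
        have hne : some (⟨w, j⟩ : Copy a b) ≠ some ⟨w, i⟩ := by simpa using hj
        simp only [copyVec, Pi.add_apply, Pi.single_eq_same, Pi.single_eq_of_ne hne]
        split_ifs <;> omega
    · have hne : some (⟨w, j⟩ : Copy a b) ≠ some ⟨v, i⟩ := by
        simp only [ne_eq, Option.some.injEq]
        exact fun h => hw (congrArg Sigma.fst h)
      simp [copyVec, hw]

variable [Fintype V] (a b) (M D N : ℕ)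

/-- The edges of the game in which each vertex is replaced by its copies, together with a
sink `none`. The extra multiplicity `M` forces the copies of a vertex to fire in order. -/
def copyEdge : Option (Copy a b) → Option (Copy a b) → ℕ
  | some x, some y => E x.1 y.1 + if x.1 = y.1 then M else 0
  | some x, none => D - ∑ v, (b v - a v) * (E x.1 v + if x.1 = v then M else 0)
  | none, some _ => 0
  | none, none => N

/-- The initial configuration of the game on copies. -/
def copyInit : Option (Copy a b) → ℕ
  | some x => D + (σ x.1 + ∑ w, a w * E w x.1) - (outdeg E x.1 * (a x.1 + x.2 + 1) + M * x.2)
  | none => 0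

/-- `M` exceeds the number of chips available at a vertex, and `D` and `N` are large
compared to `M` and `D` respectively. -/
structure LargeParams : Prop where
  chips_lt : ∀ v, σ v + ∑ w, b w * E w v < M
  received_lt : ∀ v, σ v + ∑ w, b w * E w v + M * b v < D
  sent_le : ∀ v, outdeg E v * b v + M * b v ≤ D
  edges_le : ∀ w, ∑ v, (b v - a v) * (E w v + if w = v then M else 0) ≤ D
  sink_lt : Fintype.card (Copy a b) * D < N

theorem exists_largeParams : ∃ M D N, LargeParams E σ a b M D N := by
  obtain ⟨M, hM⟩ := Finite.exists_le fun v => σ v + ∑ w, b w * E w v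
  obtain ⟨D₁, h₁⟩ := Finite.exists_le fun v => σ v + ∑ w, b w * E w v + (M + 1) * b v
  obtain ⟨D₂, h₂⟩ := Finite.exists_le fun v => outdeg E v * b v + (M + 1) * b v
  obtain ⟨D₃, h₃⟩ := Finite.exists_le
    fun w => ∑ v, (b v - a v) * (E w v + if w = v then M + 1 else 0)
  refine ⟨M + 1, D₁ + D₂ + D₃ + 1, _, fun v => ?_, fun v => ?_, fun v => ?_, fun v => ?_,
    Nat.lt_succ_self _⟩
  · exact Nat.lt_succ_of_le (hM v)
  · have := h₁ v; omega
  · have := h₂ v; omega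
  · have := h₃ v; omega

variable {E σ a b M D N}

theorem LargeParams.outdeg_some (h : LargeParams E σ a b M D N) (x : Copy a b) :
    outdeg (copyEdge E a b M D N) (some x) = D := by
  have := h.edges_le x.1
  rw [outdeg, Fintype.sum_option]
  simp only [copyEdge]
  rw [sum_copy fun v => E x.1 v + if x.1 = v then M else 0]
  omega

theorem outdeg_none : outdeg (copyEdge E a b M D N) none = N := by
  rw [outdeg, Fintype.sum_option]
  simp [copyEdge]

theorem LargeParams.not_vecFirable_none (h : LargeParams E σ a b M D N) (n : V → ℕ) :
    ¬ VecFirable (copyEdge E a b M D N) (copyInit E σ a b M D) (copyVec a b n) none := by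
  have hle : ∑ x : Copy a b, copyVec a b n (some x) * copyEdge E a b M D N (some x) none ≤
      Fintype.card (Copy a b) * D := by
    rw [← smul_eq_mul, ← Finset.card_univ]
    refine Finset.sum_le_card_nsmul _ _ _ fun x _ => ?_
    simp only [copyVec, copyEdge]
    split_ifs <;> omega
  have := h.sink_lt
  rw [VecFirable, outdeg_none, Fintype.sum_option]
  simp only [copyInit, copyVec] at *
  omega

theorem LargeParams.vecFirable_some_iff (h : LargeParams E σ a b M D N) {n : V → ℕ}
    (ha : a ≤ n) (hb : n ≤ b) (x : Copy a b) :
    VecFirable (copyEdge E a b M D N) (copyInit E σ a b M D) (copyVec a b n) (some x) ↔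
      a x.1 + x.2 = n x.1 ∧ VecFirable E σ n x.1 := by
  obtain ⟨v, i⟩ := x
  have hi := i.2
  have hav : a v ≤ n v := ha v
  have hbv : n v ≤ b v := hb v
  have hsum : ∑ x : Copy a b, copyVec a b n (some x) *
      copyEdge E a b M D N (some x) (some ⟨v, i⟩) =
      ∑ w, (n w - a w) * E w v + M * (n v - a v) := by
    simp only [copyEdge]
    rw [sum_copyVec_mul (ha.trans hb) hb (fun w => E w v + if w = v then M else 0)]
    simp [mul_add, Finset.sum_add_distrib, mul_comm]
  have hsplit : ∑ w, a w * E w v + ∑ w, (n w - a w) * E w v = ∑ w, n w * E w v := by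
    rw [← Finset.sum_add_distrib]
    refine Finset.sum_congr rfl fun w _ => ?_
    rw [← add_mul, Nat.add_sub_cancel' (ha w)]
  have hnb : ∑ w, n w * E w v ≤ ∑ w, b w * E w v := by
    gcongr with w
    exact hb w
  have hchips := h.chips_lt v
  have hrec := h.received_lt v
  have hsent := h.sent_le v
  have h1 : outdeg E v * (a v + i + 1) ≤ outdeg E v * b v := by gcongr; omega
  have h2 : M * i ≤ M * b v := by gcongr; omega
  have h3 : M * (n v - a v) ≤ M * b v := by gcongr; omega
  rw [VecFirable, VecFirable, h.outdeg_some, Fintype.sum_option, hsum]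
  simp only [copyInit, copyVec, zero_mul, zero_add]
  by_cases hlt : a v + i < n v
  · simp only [hlt, if_true]
    constructor
    · intro; omega
    · rintro ⟨h, -⟩; omega
  · simp only [hlt, if_false]
    rcases (not_lt.1 hlt).eq_or_lt with heq | hgt
    · have : n v - a v = i := by omega
      rw [this, ← heq]
      rw [← heq] at h1
      constructor
      · intro; exact ⟨rfl, by omega⟩
      · rintro ⟨-, _⟩; omega
    · have h4 : M * (n v - a v + 1) ≤ M * i := by gcongr; omega
      rw [mul_add, mul_one] at h4
      constructor
      · intro; omega
      · rintro ⟨h, -⟩; omega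

theorem LargeParams.vecReach_copyVec (h : LargeParams E σ a b M D N) {n : V → ℕ}
    (hn : VecReach (VecFirable E σ) a n) (hb : n ≤ b) :
    VecReach (VecFirable (copyEdge E a b M D N) (copyInit E σ a b M D)) 0 (copyVec a b n) := by
  induction hn with
  | refl => rw [copyVec_self]
  | @tail m _ hm hs ih =>
    obtain ⟨v, hv, rfl⟩ := hs
    have hmb : m ≤ b := le_trans (le_add_of_nonneg_right (zero_le)) hb
    have hvb : (m + Pi.single v 1 : V → ℕ) v ≤ b v := hb v
    have hva : a v ≤ m v := VecReach.le hm v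
    simp only [Pi.add_apply, Pi.single_eq_same] at hvb
    let x : Copy a b := ⟨v, ⟨m v - a v, by omega⟩⟩
    have hx : a x.1 + x.2 = m x.1 := Nat.add_sub_cancel' hva
    exact (ih hmb).tail ⟨some x, (h.vecFirable_some_iff (VecReach.le hm) hmb x).2 ⟨hx, hv⟩,
      copyVec_add_single x hx⟩

theorem LargeParams.exists_copyVec_eq (h : LargeParams E σ a b M D N) (hab : a ≤ b)
    {m : Option (Copy a b) → ℕ}
    (hm : VecReach (VecFirable (copyEdge E a b M D N) (copyInit E σ a b M D)) 0 m) :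
    ∃ n, VecReach (VecFirable E σ) a n ∧ n ≤ b ∧ copyVec a b n = m := by
  induction hm with
  | refl => exact ⟨a, .refl, hab, copyVec_self⟩
  | tail _ hs ih =>
    obtain ⟨y, hy, rfl⟩ := hs
    obtain ⟨n, hn, hb, rfl⟩ := ih
    rcases y with _ | x
    · exact absurd hy (h.not_vecFirable_none n)
    · obtain ⟨hx, hv⟩ := (h.vecFirable_some_iff hn.le hb x).1 hy
      refine ⟨_, hn.tail ⟨x.1, hv, rfl⟩, fun w => ?_, copyVec_add_single x hx⟩
      rcases eq_or_ne w x.1 with rfl | hw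
      · have := x.2.2
        simp only [Pi.add_apply, Pi.single_eq_same]
        omega
      · simpa [hw] using hb w

theorem LargeParams.convergent (h : LargeParams E σ a b M D N)
    (hab : VecReach (VecFirable E σ) a b) :
    Convergent (copyEdge E a b M D N) (copyInit E σ a b M D) := by
  refine convergent_iff.2 ⟨⟨_, h.vecReach_copyVec hab le_rfl⟩, ?_⟩
  rintro (_ | x) hx
  · exact h.not_vecFirable_none b hx
  · have := ((h.vecFirable_some_iff hab.le le_rfl x).1 hx).1
    have := x.2.2
    omega

theorem cfgSpace_Icc_feasible (a b : Feasible E σ) (hab : a ≤ b) : CFGSpace (Set.Icc a b) := by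
  obtain ⟨M, D, N, h⟩ := exists_largeParams E σ a.1 b.1
  refine (cfgSpace_iff _).2 ⟨Option (Copy a.1 b.1), inferInstance, inferInstance,
    copyEdge E a.1 b.1 M D N, copyInit E σ a.1 b.1 M D,
    h.convergent ((a.vecReach_iff b).2 hab), ⟨?_⟩⟩
  let f : Set.Icc a b ↪o Feasible (copyEdge E a.1 b.1 M D N) (copyInit E σ a.1 b.1 M D) :=
    OrderEmbedding.ofMapLEIff
      (fun n => ⟨copyVec a.1 b.1 n.1.1,
        h.vecReach_copyVec ((a.vecReach_iff n.1).2 n.2.1) n.2.2⟩)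
      (fun n m => copyVec_le_iff (n := n.1.1) m.2.1 n.2.2)
  refine RelIso.ofSurjective f fun m => ?_
  obtain ⟨n, hn, hb, he⟩ := h.exists_copyVec_eq hab m.2
  exact ⟨⟨⟨n, a.2.trans hn⟩, hn.le, hb⟩, Subtype.ext he⟩

end Interval

theorem _root_.CFGSpace.of_orderIso {α β : Type*} [Preorder α] [Preorder β] (e : α ≃o β)
    (h : CFGSpace β) : CFGSpace α := by
  obtain ⟨V, iF, iD, E, σ, hc, e', he'⟩ := h
  exact ⟨V, iF, iD, E, σ, hc, e.toEquiv.trans e',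
    fun x y => e.le_iff_le.symm.trans (he' (e x) (e y))⟩

/-- An order isomorphism restricts to an isomorphism of intervals. -/
def iccOrderIso {α β : Type*} [Preorder α] [Preorder β] (e : α ≃o β) (a b : α) :
    Set.Icc a b ≃o Set.Icc (e a) (e b) where
  toEquiv := e.toEquiv.subtypeEquiv fun x => by simp
  map_rel_iff' := e.le_iff_le

end ChipFiring

/-- if a finite lattice `L` is order-isomorphic to the configuration space of
some convergent CFG, then so is every interval `[a, b]` of `L`. -/
theorem interval_CFGSpace (L : Type*) [Lattice L] [Fintype L] (h : CFGSpace L)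
    (a b : L) (hab : a ≤ b) : CFGSpace (Set.Icc a b) := by
  obtain ⟨V, _, _, E, σ, -, ⟨e⟩⟩ := (ChipFiring.cfgSpace_iff L).1 h
  exact (ChipFiring.cfgSpace_Icc_feasible (e a) (e b) (e.monotone hab)).of_orderIso
    (ChipFiring.iccOrderIso e a b)
end

section
/- Every finite distributive lattice is order-isomorphic to the configuration space of some convergent chip firing game. -/
lemma isLowerSet_insert_of_forall_lt {P : Type*} [PartialOrder P] [DecidableEq P]
    {I : Finset P} (hI : IsLowerSet (I : Set P)) {p : P} (hlt : ∀ q < p, q ∈ I) :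
    IsLowerSet (↑(insert p I) : Set P) := by
  intro a b hba ha
  simp only [Finset.coe_insert, Set.mem_insert_iff, Finset.mem_coe] at ha ⊢
  rcases ha with rfl | ha
  · exact hba.eq_or_lt.imp_right (hlt b)
  · exact Or.inr (hI hba ha)

section IdealGame

variable {P : Type*} [PartialOrder P] [Fintype P]

open Classical in
/-- The edges of a game on a finite poset `P` with an added sink `none`. Each element sends one
chip to every larger element and `#P + 1` chips to the sink, whose loops are so many that it can
never be fired. -/
noncomputable def idealEdges (P : Type*) [PartialOrder P] [Fintype P] : Option P → Option P → ℕ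
  | some p, some q => if p < q then 1 else 0
  | some _, none => Fintype.card P + 1
  | none, some _ => 0
  | none, none => (Fintype.card P + 1) * Fintype.card P + 1

open Finset Classical in
/-- The configuration of the game `idealEdges P` in which exactly the elements of `I` have been
fired. -/
noncomputable def idealConfig (I : Finset P) : Option P → ℕ
  | some p => if p ∈ I then 0 else outdeg (idealEdges P) (some p) - #{q | q < p ∧ q ∉ I}
  | none => (Fintype.card P + 1) * #I

lemma card_lt_outdeg_idealEdges (p : P) :
    Fintype.card P < outdeg (idealEdges P) (some p) := by
  simp only [outdeg, Fintype.sum_option, idealEdges]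
  omega

lemma outdeg_idealEdges_none :
    outdeg (idealEdges P) none = (Fintype.card P + 1) * Fintype.card P + 1 := by
  simp [outdeg, idealEdges]

open Classical in
lemma idealConfig_some_eq_zero_iff {I : Finset P} {p : P} :
    idealConfig I (some p) = 0 ↔ p ∈ I := by
  have h₁ := card_lt_outdeg_idealEdges p
  have h₂ := Finset.card_le_univ (Finset.univ.filter fun q => q < p ∧ q ∉ I)
  simp only [idealConfig]
  split_ifs with h
  · simp [h]
  · simp only [h, iff_false]
    omega

lemma idealConfig_injective : Function.Injective (idealConfig (P := P)) := fun I J h => by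
  ext p
  rw [← idealConfig_some_eq_zero_iff, h, idealConfig_some_eq_zero_iff]

open Classical in
lemma firable_idealConfig_iff {I : Finset P} {v : Option P} :
    Firable (idealEdges P) (idealConfig I) v ↔
      ∃ p, v = some p ∧ p ∉ I ∧ ∀ q < p, q ∈ I := by
  cases v with
  | none =>
    have h := Nat.mul_le_mul_left (Fintype.card P + 1) (Finset.card_le_univ I)
    simp only [Firable, outdeg_idealEdges_none, idealConfig, reduceCtorEq, false_and, exists_false,
      iff_false]
    omega
  | some p =>
    have h₁ := card_lt_outdeg_idealEdges p
    have h₂ : (Finset.univ.filter fun q => q < p ∧ q ∉ I).card = 0 ↔ ∀ q < p, q ∈ I := by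
      simp [Finset.filter_eq_empty_iff]
    simp only [Firable, idealConfig, Option.some.injEq, exists_eq_left', ← h₂]
    split_ifs with h
    · simp only [h, not_true_eq_false, false_and, iff_false]
      omega
    · simp only [h, not_false_eq_true, true_and]
      omega

open Classical in
lemma fire_idealConfig {I : Finset P} (hI : IsLowerSet (I : Set P)) {p : P} (hp : p ∉ I)
    (hlt : ∀ q < p, q ∈ I) :
    fire (idealEdges P) (idealConfig I) (some p) = idealConfig (insert p I) := by
  funext w
  cases w with
  | none => simp [fire, idealConfig, idealEdges, Finset.card_insert_of_notMem hp, mul_add]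
  | some q =>
    simp only [fire, Option.some.injEq]
    rcases eq_or_ne q p with rfl | hqp
    · have hq : (Finset.univ.filter fun r => r < q ∧ r ∉ I) = ∅ := by
        simpa [Finset.filter_eq_empty_iff] using hlt
      simp [idealConfig, idealEdges, hp, hq]
    by_cases hq : q ∈ I
    · have hpq : ¬ p < q := fun h => hp (hI h.le hq)
      simp [idealConfig, idealEdges, hq, hqp, hpq]
    · have h₁ := card_lt_outdeg_idealEdges q
      have h₂ := Finset.card_le_univ (Finset.univ.filter fun r => r < q ∧ r ∉ I)
      have h₃ : (Finset.univ.filter fun r => r < q ∧ r ∉ insert p I) =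
          (Finset.univ.filter fun r => r < q ∧ r ∉ I).erase p := by
        ext r
        simp
        tauto
      have hq' : q ∉ insert p I := by simp [hqp, hq]
      simp only [idealConfig, idealEdges, hq, hq', hqp, if_false, h₃,
        Finset.card_erase_eq_ite, Finset.mem_filter_univ, hp, not_false_eq_true, and_true]
      by_cases hpq : p < q
      · have h₄ : 0 < (Finset.univ.filter fun r => r < q ∧ r ∉ I).card :=
          Finset.card_pos.2 ⟨p, by simp [hpq, hp]⟩
        simp only [hpq, if_true]
        omega
      · simp [hpq]

open Classical in
lemma exists_idealConfig_of_reachable {I : Finset P} (hI : IsLowerSet (I : Set P))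
    {τ : Option P → ℕ} (h : Reachable (idealEdges P) (idealConfig I) τ) :
    ∃ J : Finset P, IsLowerSet (J : Set P) ∧ I ⊆ J ∧ τ = idealConfig J := by
  obtain ⟨l, hl, rfl⟩ := h
  induction l generalizing I with
  | nil => exact ⟨I, hI, subset_rfl, rfl⟩
  | cons v l ih =>
    obtain ⟨hv, hl⟩ := hl
    obtain ⟨p, rfl, hp, hlt⟩ := firable_idealConfig_iff.1 hv
    rw [fire_idealConfig hI hp hlt] at hl
    obtain ⟨J, hJ, hIJ, h⟩ := ih (isLowerSet_insert_of_forall_lt hI hlt) hl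
    refine ⟨J, hJ, (Finset.subset_insert p I).trans hIJ, ?_⟩
    rw [← h, fireList, fire_idealConfig hI hp hlt]

open Classical in
lemma reachable_idealConfig_of_subset {I J : Finset P} (hI : IsLowerSet (I : Set P))
    (hJ : IsLowerSet (J : Set P)) (hIJ : I ⊆ J) :
    Reachable (idealEdges P) (idealConfig I) (idealConfig J) := by
  induction hn : (J \ I).card generalizing I with
  | zero =>
    rw [Finset.card_eq_zero, Finset.sdiff_eq_empty_iff_subset] at hn
    rw [hIJ.antisymm hn]
    exact ⟨[], trivial, rfl⟩
  | succ n ih =>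
    obtain ⟨p, hp⟩ := (J \ I).exists_minimal (Finset.card_pos.1 (by omega))
    obtain ⟨hpJ, hpI⟩ := Finset.mem_sdiff.1 hp.prop
    have hlt : ∀ q < p, q ∈ I := fun q hq => by
      by_contra hqI
      exact hp.not_lt (Finset.mem_sdiff.2 ⟨hJ hq.le hpJ, hqI⟩) hq
    obtain ⟨l, hl, h⟩ := ih (isLowerSet_insert_of_forall_lt hI hlt)
      (Finset.insert_subset hpJ hIJ)
      (by rw [Finset.sdiff_insert, Finset.card_erase_of_mem hp.prop, hn, Nat.add_sub_cancel])
    rw [← fire_idealConfig hI hpI hlt] at hl h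
    exact ⟨some p :: l, ⟨firable_idealConfig_iff.2 ⟨p, rfl, hpI, hlt⟩, hl⟩, h⟩

open Classical in
lemma reachable_idealConfig_iff {I J : Finset P} (hI : IsLowerSet (I : Set P))
    (hJ : IsLowerSet (J : Set P)) :
    Reachable (idealEdges P) (idealConfig I) (idealConfig J) ↔ I ⊆ J := by
  refine ⟨fun h => ?_, reachable_idealConfig_of_subset hI hJ⟩
  obtain ⟨K, -, hIK, h⟩ := exists_idealConfig_of_reachable hI h
  rwa [idealConfig_injective h]

end IdealGame

/-- every finite distributive lattice is order-isomorphic to the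
configuration space of some convergent chip firing game. -/
theorem distrib_CFGSpace (L : Type*) [DistribLattice L] [Fintype L] [Nonempty L] :
    CFGSpace L := by
  classical
  let := Fintype.toOrderBot L
  let P := {a : L // SupIrred a}
  let f : L ≃o LowerSet (Shrink.{0} P) :=
    OrderIso.lowerSetSupIrred.trans (LowerSet.map (orderIsoShrink.{0} P))
  have := Fintype.ofFinite (Shrink.{0} P)
  let g : LowerSet (Shrink.{0} P) ≃ {τ // Reachable (idealEdges (Shrink.{0} P))
      (idealConfig (∅ : Finset (Shrink.{0} P))) τ} :=
    Equiv.ofBijective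
      (fun I => ⟨idealConfig (I : Set (Shrink.{0} P)).toFinset,
        (reachable_idealConfig_iff (by simp [isLowerSet_empty]) (by simp [I.lower])).2
          (Finset.empty_subset _)⟩)
      (by
        refine ⟨fun I J h => ?_, fun ⟨τ, h⟩ => ?_⟩
        · have := idealConfig_injective (Subtype.ext_iff.1 h)
          simpa using this
        · obtain ⟨J, hJ, -, rfl⟩ := exists_idealConfig_of_reachable (by simp [isLowerSet_empty]) h
          exact ⟨⟨J, hJ⟩, by simp⟩)
  refine ⟨Option (Shrink.{0} P), inferInstance, inferInstance, idealEdges _, idealConfig ∅,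
    ⟨idealConfig Finset.univ, ?_, fun v hv => ?_⟩, f.toEquiv.trans g, fun x y => ?_⟩
  · exact (reachable_idealConfig_iff (by simp [isLowerSet_empty])
      (by simp [isLowerSet_univ])).2 (Finset.empty_subset _)
  · obtain ⟨p, -, hp, -⟩ := firable_idealConfig_iff.1 hv
    exact hp (Finset.mem_univ p)
  · rw [← f.le_iff_le]
    refine Iff.trans ?_ (reachable_idealConfig_iff (by simp [(f x).lower])
      (by simp [(f y).lower])).symm
    simp
end

section
/- Let L be a finite lattice, j a join-irreducible element of L, and x ∈ L with j ≰ x. Then there exists a meet-irreducible element m of L with x ≤ m and j ↑ m (that is, j ≰ m and j ≤ m⁺). -/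
/-- An element of a lattice is join-irreducible if it has exactly one lower cover. -/
def JoinIrred {L : Type*} [Lattice L] (j : L) : Prop := ∃! a : L, a ⋖ j

/-- An element of a lattice is meet-irreducible if it has exactly one upper cover. -/
def MeetIrred {L : Type*} [Lattice L] (m : L) : Prop := ∃! b : L, m ⋖ b

/-- in a finite lattice, if `j` is join-irreducible and `j ≰ x`, then there
is a meet-irreducible `m` with `x ≤ m` and `j ↑ m`, i.e. `j ≰ m` and `j ≤ m⁺` (`j` is
below the unique upper cover of `m`). -/
theorem exists_meetIrred_upArrow {L : Type*} [Lattice L] [Fintype L]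
    (j x : L) (hj : JoinIrred j) (hjx : ¬ j ≤ x) :
    ∃ m : L, MeetIrred m ∧ x ≤ m ∧ ¬ j ≤ m ∧ ∀ b : L, m ⋖ b → j ≤ b := by
  obtain ⟨m, ⟨hxm, hjm⟩, hmax⟩ :=
    (Set.toFinite {m : L | x ≤ m ∧ ¬ j ≤ m}).exists_maximal ⟨x, le_rfl, hjx⟩
  have j_le_of_lt : ∀ y, m < y → j ≤ y := fun y hy => by
    by_contra hjy
    exact hy.not_ge (hmax ⟨hxm.trans hy.le, hjy⟩ hy.le)
  have hlt : m < m ⊔ j := left_lt_sup.2 hjm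
  refine ⟨m, ⟨m ⊔ j, ⟨hlt, fun c hmc hc => ?_⟩, fun b hb => ?_⟩, hxm, hjm,
    fun b hb => j_le_of_lt b hb.lt⟩
  · exact hc.not_ge (sup_le hmc.le (j_le_of_lt c hmc))
  · exact ((sup_le hb.le (j_le_of_lt b hb.lt)).eq_of_not_lt (hb.2 hlt)).symm
end

section
/- Let L be a finite upper locally distributive lattice, m a meet-irreducible element of L, and x ∈ L with x ≰ m. Then there exists a join-irreducible element j of L with j ≤ x and j ↕ m (that is, j ≰ m, j⁻ ≤ m and j ≤ m⁺). -/
open Classical in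
/-- The join of all upper covers of `x` (equal to `x` itself when `x` has no upper
cover). -/
noncomputable def covJoin {L : Type*} [Lattice L] [Fintype L] (x : L) : L :=
  (insert x (Finset.univ.filter (fun y => x ⋖ y))).sup' (Finset.insert_nonempty _ _) id

/-- A finite lattice is upper locally distributive (ULD) if for every `x`, the interval
between `x` and the join of all upper covers of `x` is order-isomorphic to the powerset
(ordered by inclusion) of the set of upper covers of `x`. -/
def IsULD (L : Type*) [Lattice L] [Fintype L] : Prop :=
  ∀ x : L, Nonempty ((Set.Icc x (covJoin x)) ≃o Set {y : L // x ⋖ y})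

/-- `UpDown j m` is the relation `j ↕ m`: `j ≰ m`, `j⁻ ≤ m` (every lower cover of `j`
is below `m`) and `j ≤ m⁺` (`j` is below every upper cover of `m`). -/
def UpDown {L : Type*} [Lattice L] (j m : L) : Prop :=
  ¬ j ≤ m ∧ (∀ a : L, a ⋖ j → a ≤ m) ∧ (∀ b : L, m ⋖ b → j ≤ b)

/-- The cover relation of a closed interval is the restriction of that of the ambient order. -/
theorem covBy_coe_Icc_iff {L : Type*} [PartialOrder L] {a b : L} {u v : Set.Icc a b} :
    (u : L) ⋖ v ↔ u ⋖ v := by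
  refine Set.OrdConnected.apply_covBy_apply_iff (OrderEmbedding.subtype (· ∈ Set.Icc a b)) ?_
  simpa using! Set.ordConnected_Icc (a := a) (b := b)

theorem CovBy.le_covJoin {L : Type*} [Lattice L] [Fintype L] {z y : L} (h : z ⋖ y) :
    y ≤ covJoin z := by
  classical
  exact Finset.le_sup' (f := id) (Finset.mem_insert_of_mem (Finset.mem_filter.2 ⟨Finset.mem_univ y, h⟩))

/-- Two distinct upper covers of an element of a ULD lattice are covered by their join. -/
theorem IsULD.covBy_sup {L : Type*} [Lattice L] [Fintype L] (hULD : IsULD L) {z x y : L}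
    (hx : z ⋖ x) (hy : z ⋖ y) (hne : x ≠ y) : x ⋖ x ⊔ y := by
  obtain ⟨e⟩ := hULD z
  let z' : Set.Icc z (covJoin z) := ⟨z, le_rfl, hx.le.trans hx.le_covJoin⟩
  let x' : Set.Icc z (covJoin z) := ⟨x, hx.le, hx.le_covJoin⟩
  let y' : Set.Icc z (covJoin z) := ⟨y, hy.le, hy.le_covJoin⟩
  let s : Set.Icc z (covJoin z) :=
    ⟨x ⊔ y, hx.le.trans le_sup_left, sup_le hx.le_covJoin hy.le_covJoin⟩
  have hzx : e z' ⋖ e x' := (apply_covBy_apply_iff e).2 (covBy_coe_Icc_iff.1 hx)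
  have hzy : e z' ⋖ e y' := (apply_covBy_apply_iff e).2 (covBy_coe_Icc_iff.1 hy)
  have hne' : e x' ≠ e y' := fun h => hne (congrArg Subtype.val (e.injective h))
  have hinf : e x' ⊓ e y' = e z' := hzx.wcovBy.inf_eq hzy.wcovBy hne'
  have hcov : e x' ⋖ e x' ⊔ e y' :=
    covBy_sup_of_inf_covBy_right (hinf.symm ▸ hzy)
  have hs : e s = e x' ⊔ e y' := by
    apply le_antisymm
    · rw [← e.le_symm_apply]
      have h₁ : x' ≤ e.symm (e x' ⊔ e y') := e.le_symm_apply.2 le_sup_left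
      have h₂ : y' ≤ e.symm (e x' ⊔ e y') := e.le_symm_apply.2 le_sup_right
      exact sup_le (α := L) h₁ h₂
    · exact sup_le (e.monotone (le_sup_left (α := L))) (e.monotone (le_sup_right (α := L)))
  rw [← hs] at hcov
  exact covBy_coe_Icc_iff.2 ((apply_covBy_apply_iff e).1 hcov)

/-- A ULD lattice is upper semimodular. -/
theorem IsULD.covBy_sup_of_covBy_of_le {L : Type*} [Lattice L] [Fintype L] (hULD : IsULD L)
    {a j : L} (haj : a ⋖ j) (m : L) (ham : a ≤ m) (hjm : ¬ j ≤ m) : m ⋖ m ⊔ j := by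
  induction m using WellFoundedLT.induction with
  | ind m ih =>
    rcases ham.eq_or_lt with rfl | hlt
    · rwa [sup_eq_right.2 haj.le]
    · obtain ⟨c, hac, hcm⟩ := exists_le_covBy_of_lt hlt
      have hc := ih c hcm.lt hac fun h => hjm (h.trans hcm.le)
      have hne : m ≠ c ⊔ j := fun h => hjm (h ▸ le_sup_right)
      simpa [← sup_assoc, sup_eq_left.2 hcm.le] using hULD.covBy_sup hcm hc hne

/-- in a finite upper locally distributive lattice, if `m` is
meet-irreducible and `x ≰ m`, then there is a join-irreducible `j` with `j ≤ x` and
`j ↕ m`, i.e. `j ≰ m`, `j⁻ ≤ m` and `j ≤ m⁺`. -/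
theorem exists_joinIrred_upDownArrow {L : Type*} [Lattice L] [Fintype L]
    (hULD : IsULD L) (m x : L) (hm : MeetIrred m) (hxm : ¬ x ≤ m) :
    ∃ j : L, JoinIrred j ∧ j ≤ x ∧ UpDown j m := by
  obtain ⟨j, ⟨hjx, hjm⟩, hmin⟩ :=
    (wellFounded_lt (α := L)).has_min {j | j ≤ x ∧ ¬ j ≤ m} ⟨x, le_rfl, hxm⟩
  have hlt : ∀ a, a < j → a ≤ m := fun a ha => by
    by_contra h
    exact hmin a ⟨ha.le.trans hjx, h⟩ ha
  obtain ⟨a, -, haj⟩ := exists_le_covBy_of_lt (inf_lt_left.2 hjm)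
  refine ⟨j, ⟨a, haj, fun b hbj => ?_⟩, hjx, hjm, fun b hb => hlt b hb.lt, fun b hb => ?_⟩
  · by_contra hne
    exact hjm (hbj.wcovBy.sup_eq haj.wcovBy hne ▸ sup_le (hlt b hbj.lt) (hlt a haj.lt))
  · have hcov := hULD.covBy_sup_of_covBy_of_le haj m (hlt a haj.lt) hjm
    exact hm.unique hcov hb ▸ le_sup_right
end

section
/- In a finite upper locally distributive lattice L, every maximal chain from the bottom element to the top element has length equal to the number of meet-irreducible elements of L; in particular, L is ranked. -/
theorem CovBy.inf_eq_of_not_le {L : Type*} [Lattice L] {x y a : L} (h : x ⋖ y) (hxa : x ≤ a)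
    (hya : ¬ y ≤ a) : y ⊓ a = x :=
  (h.eq_or_eq (le_inf h.le hxa) inf_le_left).resolve_right fun e => hya (e ▸ inf_le_right)

theorem CovBy.not_le_of_ne {L : Type*} [Lattice L] {x y a : L} (hy : x ⋖ y) (ha : x ⋖ a)
    (hne : y ≠ a) : ¬ y ≤ a := fun h =>
  (ha.eq_or_eq hy.le h).elim hy.lt.ne' hne

section UpperLocallyDistributive

variable {L : Type*} [Lattice L] [Fintype L] {x y a b : L}

theorem le_covJoin (x : L) : x ≤ covJoin x :=
  Finset.le_sup' (f := id) (by simp)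

theorem CovBy.le_covJoin_s14 (h : x ⋖ y) : y ≤ covJoin x :=
  Finset.le_sup' (f := id) (by simp [h])

theorem IsULD.inf_sup_left_of_mem_Icc (hL : IsULD L) {u v w : L}
    (hu : u ∈ Set.Icc x (covJoin x)) (hv : v ∈ Set.Icc x (covJoin x))
    (hw : w ∈ Set.Icc x (covJoin x)) : u ⊓ (v ⊔ w) = (u ⊓ v) ⊔ (u ⊓ w) := by
  obtain ⟨e⟩ := hL x
  have h : (⟨u, hu⟩ : Set.Icc x (covJoin x)) ⊓ (⟨v, hv⟩ ⊔ ⟨w, hw⟩) =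
      (⟨u, hu⟩ ⊓ ⟨v, hv⟩) ⊔ (⟨u, hu⟩ ⊓ ⟨w, hw⟩) := by
    apply e.injective
    simp only [OrderIso.map_inf, OrderIso.map_sup, inf_sup_left]
  exact congrArg Subtype.val h

theorem IsULD.not_le_sup_of_covBy (hL : IsULD L) (hy : x ⋖ y) (ha : x ⋖ a) (hb : x ⋖ b)
    (hya : y ≠ a) (hyb : y ≠ b) : ¬ y ≤ a ⊔ b := by
  intro h
  have hd := hL.inf_sup_left_of_mem_Icc ⟨hy.le, hy.le_covJoin_s14⟩ ⟨ha.le, ha.le_covJoin_s14⟩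
    ⟨hb.le, hb.le_covJoin_s14⟩
  rw [hy.inf_eq_of_not_le ha.le (hy.not_le_of_ne ha hya),
    hy.inf_eq_of_not_le hb.le (hy.not_le_of_ne hb hyb), inf_eq_left.2 h, sup_idem] at hd
  exact hy.lt.ne' hd

theorem IsULD.covBy_sup_of_covBy (hL : IsULD L) (ha : x ⋖ a) (hb : x ⋖ b) (hne : b ≠ a) :
    a ⋖ a ⊔ b := by
  refine ⟨left_lt_sup.2 (hb.not_le_of_ne ha hne), fun z haz hz => ?_⟩
  have hab : a ⊔ b ≤ covJoin x := sup_le ha.le_covJoin_s14 hb.le_covJoin_s14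
  have hd := hL.inf_sup_left_of_mem_Icc ⟨ha.le.trans haz.le, hz.le.trans hab⟩
    ⟨ha.le, ha.le_covJoin_s14⟩ ⟨hb.le, hb.le_covJoin_s14⟩
  have hbz : ¬ b ≤ z := fun h => hz.not_ge (sup_le haz.le h)
  rw [inf_eq_left.2 hz.le, inf_eq_right.2 haz.le, inf_comm z b,
    hb.inf_eq_of_not_le (ha.le.trans haz.le) hbz, sup_eq_left.2 ha.le] at hd
  exact haz.ne' hd

theorem IsULD.covBy_sup_s14 (hL : IsULD L) (h : x ⋖ y) (hxa : x ≤ a) (hya : ¬ y ≤ a) :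
    a ⋖ a ⊔ y := by
  induction x using WellFoundedGT.induction generalizing y with
  | ind x ih =>
    obtain rfl | hlt := hxa.eq_or_lt
    · rwa [sup_eq_right.2 h.le]
    obtain ⟨z, hxz, hza⟩ := exists_covBy_le_of_lt hlt
    have hyz : y ≠ z := by rintro rfl; exact hya hza
    have := ih z hxz.lt (hL.covBy_sup_of_covBy hxz h hyz) hza
      (fun hle => hya (le_sup_right.trans hle))
    rwa [← sup_assoc, sup_eq_left.2 hza] at this

theorem IsULD.not_le_sup (hL : IsULD L) (h : x ⋖ y) (hxa : x ≤ a) (hxb : x ≤ b)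
    (hya : ¬ y ≤ a) (hyb : ¬ y ≤ b) : ¬ y ≤ a ⊔ b := by
  induction x using WellFoundedGT.induction generalizing y a b with
  | ind x ih =>
    obtain rfl | hlta := hxa.eq_or_lt
    · rwa [sup_eq_right.2 hxb]
    obtain rfl | hltb := hxb.eq_or_lt
    · rwa [sup_eq_left.2 hxa]
    have step : ∀ {z u v : L}, x ⋖ z → z ≤ u → z ≤ v → ¬ y ≤ u → ¬ y ≤ v → ¬ y ≤ u ⊔ v := by
      intro z u v hz hu hv hyu hyv hle
      have hyz : y ≠ z := by rintro rfl; exact hyu hu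
      exact ih z hz.lt (hL.covBy_sup_of_covBy hz h hyz) hu hv
        (fun hle => hyu (le_sup_right.trans hle)) (fun hle => hyv (le_sup_right.trans hle))
        (sup_le (hu.trans le_sup_left) hle)
    obtain ⟨a', hxa', haa⟩ := exists_covBy_le_of_lt hlta
    obtain ⟨b', hxb', hbb⟩ := exists_covBy_le_of_lt hltb
    have hw : ¬ y ≤ a' ⊔ b' := hL.not_le_sup_of_covBy h hxa' hxb'
      (by rintro rfl; exact hya haa) (by rintro rfl; exact hyb hbb)
    have hab : ¬ y ≤ a ⊔ b' := by
      have := step hxa' haa le_sup_left hya hw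
      rwa [← sup_assoc, sup_eq_left.2 haa] at this
    have := step hxb' le_sup_right hbb hab hyb
    rwa [sup_assoc, sup_eq_right.2 hbb] at this

theorem IsULD.existsUnique_meetIrred (hL : IsULD L) (h : x ⋖ y) :
    ∃! m : L, MeetIrred m ∧ x ≤ m ∧ ¬ y ≤ m := by
  obtain ⟨m, hm⟩ :=
    (Set.toFinite {z : L | x ≤ z ∧ ¬ y ≤ z}).exists_maximal ⟨x, le_rfl, h.lt.not_ge⟩
  have hlt : ∀ z, m < z → y ≤ z := fun z hz => by
    by_contra hyz
    exact hz.not_ge (hm.2 ⟨hm.1.1.trans hz.le, hyz⟩ hz.le)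
  have hcov : m ⋖ m ⊔ y := hL.covBy_sup_s14 h hm.1.1 hm.1.2
  refine ⟨m, ⟨⟨m ⊔ y, hcov, fun b hb => ?_⟩, hm.1⟩, ?_⟩
  · exact ((hb.eq_or_eq hcov.le (sup_le hb.le (hlt b hb.lt))).resolve_left hcov.lt.ne').symm
  · rintro n ⟨⟨s, hs, hsu⟩, hxn, hyn⟩
    have hns : n ⊔ y = s := hsu _ (hL.covBy_sup_s14 h hxn hyn)
    have hsup := hL.not_le_sup h hxn hm.1.1 hyn hm.1.2
    have hnm : n ≤ m := le_sup_left.trans (hm.2 ⟨hxn.trans le_sup_left, hsup⟩ le_sup_right)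
    obtain rfl | hlt' := hnm.eq_or_lt
    · rfl
    · obtain ⟨t, hnt, htm⟩ := exists_covBy_le_of_lt hlt'
      rw [hsu t hnt, ← hns] at htm
      exact (hm.1.2 (le_sup_right.trans htm)).elim

theorem IsULD.ncard_meetIrred_ge_of_covBy (hL : IsULD L) (h : x ⋖ y) :
    {m : L | MeetIrred m ∧ x ≤ m}.ncard = {m : L | MeetIrred m ∧ y ≤ m}.ncard + 1 := by
  obtain ⟨m, ⟨hm, hxm, hym⟩, hu⟩ := hL.existsUnique_meetIrred h
  rw [← Set.ncard_insert_of_notMem (a := m) (by simp [hym])]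
  congr 1
  ext n
  simp only [Set.mem_ofPred_eq, Set.mem_insert_iff]
  constructor
  · rintro ⟨hn, hxn⟩
    by_cases hyn : y ≤ n
    · exact .inr ⟨hn, hyn⟩
    · exact .inl (hu n ⟨hn, hxn, hyn⟩)
  · rintro (rfl | ⟨hn, hyn⟩)
    · exact ⟨hm, hxm⟩
    · exact ⟨hn, h.le.trans hyn⟩

end UpperLocallyDistributive

theorem IsMaxChain.exists_covBy_of_lt {α : Type*} [PartialOrder α] [Finite α] {c : Set α}
    (hc : IsMaxChain (· ≤ ·) c) {x t : α} (hx : x ∈ c) (ht : t ∈ c) (hxt : x < t) :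
    ∃ y ∈ c, x ⋖ y ∧ ∀ z ∈ c, x < z → y ≤ z := by
  obtain ⟨y, hy⟩ := (Set.toFinite {z : α | z ∈ c ∧ x < z}).exists_minimal ⟨t, ht, hxt⟩
  have hle : ∀ z ∈ c, x < z → y ≤ z := fun z hz hxz =>
    (hc.isChain.total hy.1.1 hz).elim id fun hzy => hy.2 ⟨hz, hxz⟩ hzy
  refine ⟨y, hy.1.1, ⟨hy.1.2, fun w hxw hwy => ?_⟩, hle⟩
  have hins : IsChain (· ≤ ·) (insert w c) := hc.isChain.insert fun z hz _ => by
    by_cases hxz : x < z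
    · exact .inl (hwy.le.trans (hle z hz hxz))
    · refine .inr (le_trans ?_ hxw.le)
      rcases hc.isChain.total hx hz with h | h
      · exact (h.eq_of_not_lt hxz).ge
      · exact h
  have hw : w ∈ c := by
    rw [hc.2 hins (Set.subset_insert w c)]
    exact Set.mem_insert w c
  exact hwy.not_ge (hle w hw hxw)

theorem IsULD.ncard_inter_Ici {L : Type*} [Lattice L] [Fintype L] [BoundedOrder L]
    (hL : IsULD L) {c : Set L} (hc : IsMaxChain (· ≤ ·) c) {x : L} (hx : x ∈ c) :
    (c ∩ Set.Ici x).ncard = {m : L | MeetIrred m ∧ x ≤ m}.ncard + 1 := by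
  induction x using WellFoundedGT.induction with
  | ind x ih =>
    obtain rfl | hlt := (le_top : x ≤ ⊤).eq_or_lt
    · have h₁ : c ∩ Set.Ici (⊤ : L) = {⊤} := by simpa using hx
      have h₂ : {m : L | MeetIrred m ∧ ⊤ ≤ m} = ∅ := by
        ext m
        simp only [Set.mem_ofPred_eq, top_le_iff, Set.mem_empty_iff_false, iff_false]
        rintro ⟨⟨b, hb, -⟩, rfl⟩
        exact not_top_lt hb.lt
      rw [h₁, h₂, Set.ncard_singleton, Set.ncard_empty]
    · obtain ⟨y, hy, hxy, hle⟩ := hc.exists_covBy_of_lt hx hc.top_mem hlt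
      have hins : c ∩ Set.Ici x = insert x (c ∩ Set.Ici y) := by
        ext z
        simp only [Set.mem_inter_iff, Set.mem_Ici, Set.mem_insert_iff]
        constructor
        · rintro ⟨hz, hxz⟩
          exact hxz.eq_or_lt.imp Eq.symm fun h => ⟨hz, hle z hz h⟩
        · rintro (rfl | ⟨hz, hyz⟩)
          · exact ⟨hx, le_rfl⟩
          · exact ⟨hz, hxy.le.trans hyz⟩
      rw [hins, Set.ncard_insert_of_notMem (fun h => hxy.lt.not_ge h.2), ih y hxy.lt hy,
        hL.ncard_meetIrred_ge_of_covBy hxy]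

/-- in a finite ULD lattice, every maximal chain from `⊥` to `⊤` has length
equal to the number of meet-irreducible elements (a chain of length `n` has `n + 1`
elements); in particular the lattice is ranked. -/
theorem maxChain_card_eq_meetIrred_card {L : Type*} [Lattice L] [Fintype L]
    [BoundedOrder L] (hULD : IsULD L) (c : Set L)
    (hc : IsMaxChain (· ≤ ·) c) (hbot : ⊥ ∈ c) (htop : ⊤ ∈ c) :
    c.ncard = {m : L | MeetIrred m}.ncard + 1 := by
  simpa using hULD.ncard_inter_Ici hc hbot
end

section
/- Let L be a finite upper locally distributive lattice with set J of join-irreducibles, and let I be a lower set of the poset J. Set x = ⋁ I. Then J_x = {j ∈ J : j ≤ x} is a lower set of J containing I, and I ~ J_x, i.e., every element of J_x \ I is ~-equivalent to some element of I. -/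
/-- Two join-irreducibles are `~`-equivalent if they share the same meet-irreducible `m`
with `j ↕ m` (in a ULD lattice, the `m` with `j ↕ m` is unique for each `j`). -/
def SimJ {L : Type*} [Lattice L] (j j' : L) : Prop :=
  ∃ m : L, MeetIrred m ∧ UpDown j m ∧ UpDown j' m

/-- `Jset x` is the set `J_x` of join-irreducibles below `x`. -/
def Jset {L : Type*} [Lattice L] (x : L) : Set L := {j : L | JoinIrred j ∧ j ≤ x}

/-- Two distinct covers of an element of a finite upper locally distributive lattice are covered
by their join. -/
theorem IsULD.covBy_sup_s17 {L : Type*} [Lattice L] [Fintype L] (hULD : IsULD L) {a b c : L}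
    (hb : a ⋖ b) (hc : a ⋖ c) (hne : b ≠ c) : c ⋖ b ⊔ c := by
  classical
  obtain ⟨e⟩ := hULD a
  have hmem : ∀ y, a ⋖ y → y ∈ Set.Icc a (covJoin a) := fun y hy =>
    ⟨hy.le, Finset.le_sup' id (by simp [hy])⟩
  let a₀ : Set.Icc a (covJoin a) := ⟨a, le_rfl, hb.le.trans (hmem b hb).2⟩
  have hcov : ∀ y (hy : a ⋖ y), e a₀ ⋖ e ⟨y, hmem y hy⟩ := by
    intro y hy
    rw [apply_covBy_apply_iff e]
    exact ⟨hy.lt, fun w h₁ h₂ => hy.2 (c := w.1) h₁ h₂⟩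
  have hne' : e ⟨b, hmem b hb⟩ ≠ e ⟨c, hmem c hc⟩ := fun h =>
    hne (congrArg Subtype.val (e.injective h))
  have hinf : e ⟨b, hmem b hb⟩ ⊓ e ⟨c, hmem c hc⟩ = e a₀ :=
    (hcov b hb).wcovBy.inf_eq (hcov c hc).wcovBy hne'
  have hsup : e ⟨c, hmem c hc⟩ ⋖ e ⟨b, hmem b hb⟩ ⊔ e ⟨c, hmem c hc⟩ :=
    covBy_sup_of_inf_covBy_left (hinf ▸ hcov b hb)
  obtain ⟨z, hz⟩ := e.surjective (e ⟨b, hmem b hb⟩ ⊔ e ⟨c, hmem c hc⟩)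
  rw [← hz, apply_covBy_apply_iff e] at hsup
  have hbz : b ≤ z.1 := e.le_iff_le.mp (hz ▸ le_sup_left : e ⟨b, hmem b hb⟩ ≤ e z)
  have hcz : c ⋖ z.1 :=
    ⟨hsup.lt, fun w h₁ h₂ =>
      hsup.2 (c := ⟨w, hc.le.trans h₁.le, h₂.le.trans z.2.2⟩) h₁ h₂⟩
  have hlt : c < b ⊔ c := right_lt_sup.mpr fun h => (hc.eq_or_eq hb.le h).elim hb.ne' hne
  rwa [(hcz.eq_or_eq hlt.le (sup_le hbz hcz.le)).resolve_left hlt.ne']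

/-- Finite upper locally distributive lattices are upper semimodular. -/
theorem IsULD.wcovBy_sup {L : Type*} [Lattice L] [Fintype L] (hULD : IsULD L) {a b c : L}
    (hb : a ⋖ b) (hac : a ≤ c) : c ⩿ b ⊔ c := by
  induction a using WellFoundedGT.induction generalizing b with
  | ind a ih =>
    by_cases hbc : b ≤ c
    · rw [sup_eq_right.mpr hbc]
      exact wcovBy_of_le_of_le le_rfl le_rfl
    obtain rfl | hlt := hac.eq_or_lt
    · rw [sup_eq_left.mpr hb.le]
      exact hb.wcovBy
    obtain ⟨d, had, hdc⟩ := exists_covBy_le_of_lt hlt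
    have h := ih d had.lt (hULD.covBy_sup_s17 hb had fun h => hbc (h ▸ hdc)) hdc
    rwa [sup_assoc, sup_eq_right.mpr hdc] at h

/-- An element minimal among those not below `m` is join-irreducible. -/
theorem joinIrred_of_minimal_not_le {L : Type*} [Lattice L] [Finite L] {j m : L}
    (hj : Minimal (fun y => ¬ y ≤ m) j) : JoinIrred j := by
  obtain ⟨p, -, hp⟩ := exists_le_covBy_of_lt (inf_lt_left.mpr hj.prop)
  refine ⟨p, hp, fun q hq => ?_⟩
  by_contra hne
  have hle : ∀ y, y ⋖ j → y ≤ m := fun y hy => not_not.mp (hj.not_prop_of_lt hy.lt)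
  exact hj.prop (hq.wcovBy.sup_eq hp.wcovBy hne ▸ sup_le (hle q hq) (hle p hp))

/-- Every join-irreducible `j` admits a meet-irreducible `m` with `j ↕ m`. -/
theorem JoinIrred.exists_upDown {L : Type*} [Lattice L] [Finite L] {j : L} (hj : JoinIrred j) :
    ∃ m, MeetIrred m ∧ UpDown j m := by
  obtain ⟨a, ha, hau⟩ := hj
  obtain ⟨m, ham, hm⟩ := (Set.toFinite {y : L | ¬ j ≤ y}).exists_le_maximal
    (show a ∈ {y : L | ¬ j ≤ y} from ha.lt.not_ge)
  have hjm : ¬ j ≤ m := hm.prop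
  have hcov : ∀ b, m ⋖ b → j ≤ b := fun b hb => not_not.mp (hm.not_prop_of_gt hb.lt)
  obtain ⟨b, hb, -⟩ := exists_covBy_le_of_lt (right_lt_sup.mpr hjm)
  refine ⟨m, ⟨b, hb, fun c hc => ?_⟩, hjm, fun y hy => (hau y hy).le.trans ham, hcov⟩
  by_contra hne
  exact hjm (hc.wcovBy.inf_eq hb.wcovBy hne ▸ le_inf (hcov c hc) (hcov b hb))

/-- let `L` be a finite ULD lattice, `I` a lower set of the poset `J` of
join-irreducibles, and `x = ⋁ I`.  Then `J_x = {j ∈ J | j ≤ x}` is a lower set of `J`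
containing `I`, and `I ~ J_x`: every element of `J_x \ I` is `~`-equivalent to some
element of `I`. -/
theorem lowerSet_join_sim {L : Type*} [Lattice L] [Fintype L] (hULD : IsULD L)
    (I : Set L) (hIJ : ∀ j ∈ I, JoinIrred j)
    (hIlow : ∀ j ∈ I, ∀ j' : L, JoinIrred j' → j' ≤ j → j' ∈ I)
    (x : L) (hx : IsLUB I x) :
    (∀ j ∈ Jset x, ∀ j' : L, JoinIrred j' → j' ≤ j → j' ∈ Jset x) ∧
    I ⊆ Jset x ∧
    (∀ j ∈ Jset x \ I, ∃ j' ∈ I, SimJ j j') := by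
  refine ⟨fun j hj j' hj' hle => ⟨hj', hle.trans hj.2⟩, fun j hj => ⟨hIJ j hj, hx.1 hj⟩, ?_⟩
  rintro j ⟨⟨hj, hjx⟩, -⟩
  obtain ⟨m, hm, hjm⟩ := hj.exists_upDown
  obtain ⟨i, hi, him⟩ : ∃ i ∈ I, ¬ i ≤ m := by
    by_contra! h
    exact hjm.1 (hjx.trans (hx.2 h))
  obtain ⟨k, hki, hk⟩ := (Set.toFinite {y : L | ¬ y ≤ m}).exists_le_minimal
    (show i ∈ {y : L | ¬ y ≤ m} from him)
  have hkm : ¬ k ≤ m := hk.prop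
  have hkJ : JoinIrred k := joinIrred_of_minimal_not_le hk
  have hlow : ∀ a, a ⋖ k → a ≤ m := fun a ha => not_not.mp (hk.not_prop_of_lt ha.lt)
  obtain ⟨a, ha, -⟩ := id hkJ
  have hmk : m ⋖ k ⊔ m :=
    (hULD.wcovBy_sup ha (hlow a ha)).covBy_of_lt (right_lt_sup.mpr hkm)
  exact ⟨k, hIlow i hi k hkJ hki, m, hm, hjm, hkm, hlow,
    fun b hb => hm.unique hmk hb ▸ le_sup_left⟩
end
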